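/- arXiv:1101.4844 — 3 statements merged into one kernel-verified Lean document; each statement's English description precedes it below -/
import Mathlib

section
/- With the hypotheses of the two-weight code eigenvalue relations, the restricted eigenvalues ρ₁ < ρ₂ of the adjacency matrix of Γ(C) satisfy: ρ₂ − ρ₁ is a positive integer dividing |C|, and w₁ = γ|C|(ρ₁+1)/((ρ₁−ρ₂)|R^×|), w₂ = γ|C|ρ₁/((ρ₁−ρ₂)|R^×|). -/
def IsHomWeight (R : Type*) [Ring R] [Fintype R] (w : R → ℝ) (γ : ℝ) : Prop :=
  w 0 = 0 ∧
  (∀ x y : R, Submodule.span R ({x} : Set R) = Submodule.span R {y} → w x = w y) ∧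
  (∀ x : R, x ≠ 0 →
    ∑ᶠ y ∈ (Submodule.span R ({x} : Set R) : Set R), w y
      = γ * Nat.card (Submodule.span R ({x} : Set R)))

def IsFrobeniusRing (R : Type*) [Ring R] [Fintype R] : Prop :=
  ∃ χ : AddChar R ℂ, ∀ φ : AddChar R ℂ, ∃ r : R, ∀ x : R, φ x = χ (r * x)

/-- The homogeneous weight extended additively to `R^n`. -/
def wN {R : Type*} [Ring R] (w : R → ℝ) {n : ℕ} (c : Fin n → R) : ℝ :=
  ∑ i, w (c i)

open scoped Classical in
theorem moebius_aux {R P M : Type*} [Fintype R] [PartialOrder P] [AddCommGroup M]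
    (p : R → P) (h : R → M)
    (H : ∀ r, ∑ s with p s ≤ p r, h s = 0) (r : R) : ∑ s with p s = p r, h s = 0 := by
  induction hN : (Finset.univ.filter fun s => p s ≤ p r).card using Nat.strong_induction_on
    generalizing r with
  | _ N ih =>
  have h1 : ∑ s with p s ≤ p r, h s = ∑ s with p s = p r, h s + ∑ s with p s < p r, h s := by
    rw [← Finset.sum_union]
    · congr 1
      ext s
      simp [le_iff_eq_or_lt]
    · rw [Finset.disjoint_left]
      intro s hs hs'
      simp only [Finset.mem_filter, Finset.mem_univ, true_and] at hs hs'
      exact absurd hs hs'.ne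
  have h2 : ∑ s with p s < p r, h s = 0 := by
    rw [← Finset.sum_fiberwise_of_maps_to
      (t := (Finset.univ.filter fun s => p s < p r).image p) (g := p)
      (fun i hi => Finset.mem_image_of_mem p hi)]
    refine Finset.sum_eq_zero fun q hq => ?_
    obtain ⟨t, ht, rfl⟩ := Finset.mem_image.1 hq
    simp only [Finset.mem_filter, Finset.mem_univ, true_and] at ht
    rw [← ih _ ?_ t rfl]
    · congr 1
      ext s
      simp only [Finset.mem_filter, Finset.mem_univ, true_and, and_iff_right_iff_imp]
      intro e
      rw [e]; exact ht
    · rw [← hN]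
      apply Finset.card_lt_card
      rw [Finset.ssubset_iff_of_subset]
      · refine ⟨r, by simp, ?_⟩
        simp only [Finset.mem_filter, Finset.mem_univ, true_and]
        exact fun h => absurd ht h.not_gt
      · intro s
        simp only [Finset.mem_filter, Finset.mem_univ, true_and]
        exact fun h => h.trans ht.le
  rw [H, h2, add_zero] at h1
  exact h1.symm

/-- translation argument -/
theorem sum_zero_of_translate {R : Type*} [AddCommGroup R] (S : Finset R) (g : R → ℂ) (a : R) (z : ℂ)
    (hS : ∀ s, s + a ∈ S ↔ s ∈ S) (hg : ∀ s, g (s + a) = g s * z) (hz : z ≠ 1) :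
    ∑ s ∈ S, g s = 0 := by
  have : ∑ s ∈ S, g s = ∑ s ∈ S, g (s + a) := by
    symm
    refine Finset.sum_bij (fun s _ => s + a) (fun s hs => (hS s).2 hs)
      (fun _ _ _ _ h => by simpa using h) (fun b hb => ⟨b - a, ?_, by simp⟩) (fun _ _ => rfl)
    rw [← hS]; simpa using hb
  simp only [hg, ← Finset.sum_mul] at this
  have h2 : (∑ s ∈ S, g s) * (z - 1) = 0 := by rw [mul_sub, ← this]; ring
  exact (mul_eq_zero.1 h2).resolve_right (sub_ne_zero.2 hz)


theorem gen_left {R : Type*} [Ring R] [Fintype R] (χ : AddChar R ℂ)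
    (hχ : ∀ φ : AddChar R ℂ, ∃ r : R, ∀ x : R, φ x = χ (r * x)) (a : R) (h : ∀ t, χ (t * a) = 1) : a = 0 := by
  by_contra ha
  obtain ⟨φ, hφ⟩ := (AddChar.exists_apply_ne_zero (a := a)).2 ha
  obtain ⟨r, hr⟩ := hχ φ
  exact hφ (by rw [hr, h])

theorem gen_right {R : Type*} [Ring R] [Fintype R] (χ : AddChar R ℂ)
    (hχ : ∀ φ : AddChar R ℂ, ∃ r : R, ∀ x : R, φ x = χ (r * x)) (a : R) (h : ∀ t, χ (a * t) = 1) : a = 0 := by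
  classical
  choose F hF using hχ
  have hinj : Function.Injective F := by
    intro φ ψ e
    ext x
    rw [hF φ, hF ψ, e]
  have hb : Function.Bijective F :=
    (Fintype.bijective_iff_injective_and_card F).2 ⟨hinj, AddChar.card_eq⟩
  obtain ⟨φ, rfl⟩ := hb.2 a
  obtain ⟨ψ, hψ⟩ := hb.2 0
  have : φ = ψ := by
    ext x
    rw [hF φ, hF ψ, h, hψ]; simp
  rw [this, hψ]

open scoped Classical in
theorem f_inv {R : Type*} [Ring R] [Fintype R] (χ : AddChar R ℂ)
    (hχ : ∀ φ : AddChar R ℂ, ∃ r : R, ∀ x : R, φ x = χ (r * x)) (x y a b : R) (hx : x = a * y) (hy : y = b * x) :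
    ∑ u : Rˣ, χ (x * u) = ∑ u : Rˣ, χ (y * u) := by
  have key := moebius_aux (fun r : R => Set.range (fun t => r * t)) (fun s => χ (x * s) - χ (y * s))
    (by
      intro r
      have hmem : ∀ s, (Set.range (fun t => s * t) ≤ Set.range (fun t => r * t)) ↔
          ∃ t, r * t = s := by
        intro s
        constructor
        · intro h
          exact h ⟨1, by simp⟩
        · rintro ⟨t, rfl⟩ _ ⟨q, rfl⟩
          exact ⟨t * q, by simp [mul_assoc]⟩
      have zz : ∀ z : R, z * r ≠ 0 →
          ∑ s with (Set.range (fun t => s * t) ≤ Set.range (fun t => r * t)), χ (z * s) = 0 := by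
        intro z hz
        have : ∃ t, χ (z * r * t) ≠ 1 := by
          by_contra hcon
          push Not at hcon
          exact hz (gen_right χ hχ _ hcon)
        obtain ⟨t, ht⟩ := this
        refine sum_zero_of_translate _ _ (r * t) _ ?_ ?_ ht
        · intro s
          simp only [Finset.mem_filter, Finset.mem_univ, true_and, hmem]
          constructor
          · rintro ⟨q, hq⟩
            exact ⟨q - t, by rw [mul_sub, hq]; simp⟩
          · rintro ⟨q, hq⟩
            exact ⟨q + t, by rw [mul_add, hq]⟩
        · intro s
          rw [mul_add, AddChar.map_add_eq_mul, mul_assoc]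
      by_cases hr : x * r = 0
      · have hr' : y * r = 0 := by rw [hy, mul_assoc, hr, mul_zero]
        apply Finset.sum_eq_zero
        intro s hs
        simp only [Finset.mem_filter, Finset.mem_univ, true_and, hmem] at hs
        obtain ⟨t, rfl⟩ := hs
        rw [← mul_assoc, ← mul_assoc, hr, hr', sub_self]
      · have hr' : y * r ≠ 0 := by
          intro h
          apply hr
          rw [hx, mul_assoc, h, mul_zero]
        rw [Finset.sum_sub_distrib, zz x hr, zz y hr', sub_zero]) 1
  have hu : ∀ g : R → ℂ, ∑ s with (Set.range (fun t : R => s * t) = Set.range (fun t : R => 1 * t)),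
      g s = ∑ u : Rˣ, g u := by
    intro g
    symm
    refine Finset.sum_bij (fun u _ => (u : R)) ?_ (fun _ _ _ _ h => Units.ext h) ?_ (fun _ _ => rfl)
    · intro u _
      simp only [Finset.mem_filter, Finset.mem_univ, true_and]
      ext z
      simp only [Set.mem_range, one_mul, exists_eq, iff_true]
      exact ⟨↑u⁻¹ * z, by simp⟩
    · intro s hs
      simp only [Finset.mem_filter, Finset.mem_univ, true_and] at hs
      have : (1 : R) ∈ Set.range (fun t : R => s * t) := by rw [hs]; exact ⟨1, by simp⟩
      obtain ⟨t, ht⟩ := this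
      have ht' : s * t = 1 := ht
      exact ⟨⟨s, t, ht', mul_eq_one_symm ht'⟩, Finset.mem_univ _, rfl⟩
  have key2 : ∑ u : Rˣ, (χ (x * u) - χ (y * u)) = 0 := by
    rw [← hu (fun s => χ (x * s) - χ (y * s))]
    convert key
  rw [Finset.sum_sub_distrib, sub_eq_zero] at key2
  exact key2

open scoped Classical in
theorem f_sum {R : Type*} [Ring R] [Fintype R] (χ : AddChar R ℂ)
    (hχ : ∀ φ : AddChar R ℂ, ∃ r : R, ∀ x : R, φ x = χ (r * x)) (x : R) (hx : x ≠ 0) :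
    ∑ y with y ∈ Submodule.span R ({x} : Set R), ∑ u : Rˣ, χ (y * u) = 0 := by
  rw [Finset.sum_comm]
  refine Finset.sum_eq_zero fun u _ => ?_
  have : ∃ t, χ (t * (x * u)) ≠ 1 := by
    by_contra hcon
    push Not at hcon
    have := gen_left χ hχ _ hcon
    exact hx (by simpa using this)
  obtain ⟨t, ht⟩ := this
  refine sum_zero_of_translate _ _ (t * x) _ ?_ ?_ ht
  · intro s
    simp only [Finset.mem_filter, Finset.mem_univ, true_and]
    exact Submodule.add_mem_iff_left _ (Submodule.smul_mem _ _ (Submodule.mem_span_singleton_self x))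
  · intro s
    rw [add_mul, AddChar.map_add_eq_mul, mul_assoc]


open scoped Classical in
theorem uniq_aux {R M : Type*} [Ring R] [Fintype R] [AddCommGroup M] [Module ℚ M] (g : R → M)
    (h0 : g 0 = 0)
    (hinv : ∀ x y : R, Submodule.span R ({x} : Set R) = Submodule.span R {y} → g x = g y)
    (hsum : ∀ x : R, x ≠ 0 → ∑ y with y ∈ Submodule.span R ({x} : Set R), g y = 0) (x : R) :
    g x = 0 := by
  have key := moebius_aux (fun r : R => Submodule.span R ({r} : Set R)) g (by
    intro r
    simp only [Submodule.span_singleton_le_iff_mem]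
    by_cases hr : r = 0
    · subst hr
      apply Finset.sum_eq_zero
      intro s hs
      simp at hs
      rw [hs, h0]
    · exact hsum r hr) x
  rw [Finset.sum_congr rfl (g := fun _ => g x) (fun s hs => hinv _ _ (by simpa using hs)),
    Finset.sum_const, ← Nat.cast_smul_eq_nsmul ℚ, smul_eq_zero] at key
  refine key.resolve_left ?_
  exact Nat.cast_ne_zero.2 (Finset.card_ne_zero.2 ⟨x, by simp⟩)

theorem span_eq_imp {R : Type*} [Ring R] {x y : R}
    (h : Submodule.span R ({x} : Set R) = Submodule.span R {y}) : ∃ a, x = a * y := by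
  have : x ∈ Submodule.span R ({y} : Set R) := h ▸ Submodule.mem_span_singleton_self x
  obtain ⟨a, ha⟩ := Submodule.mem_span_singleton.1 this
  exact ⟨a, ha.symm⟩

theorem f_int {R : Type*} [Ring R] [Fintype R] [Fintype Rˣ] (χ : AddChar R ℂ)
    (hχ : ∀ φ : AddChar R ℂ, ∃ r : R, ∀ x : R, φ x = χ (r * x)) (x : R) :
    ∃ N : ℤ, ∑ u : Rˣ, χ (x * u) = N := by
  classical
  set f : R → ℂ := fun x => ∑ u : Rˣ, χ (x * u) with hf
  obtain ⟨π, hπ⟩ := LinearMap.exists_leftInverse_of_injective (Algebra.linearMap ℚ ℂ)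
    (LinearMap.ker_eq_bot.2 (algebraMap ℚ ℂ).injective)
  have hπ' : ∀ q : ℚ, π (q : ℂ) = q := fun q => by
    have := LinearMap.congr_fun hπ q
    simpa using this
  have hfinv : ∀ x y : R, Submodule.span R ({x} : Set R) = Submodule.span R {y} → f x = f y := by
    intro x y h
    obtain ⟨a, ha⟩ := span_eq_imp h
    obtain ⟨b, hb⟩ := span_eq_imp h.symm
    simp only [hf]
    convert f_inv χ hχ x y a b ha hb
  have hfs : ∀ x : R, x ≠ 0 → ∑ y with y ∈ Submodule.span R ({x} : Set R), f y = 0 := by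
    intro x hx
    convert f_sum χ hχ x hx
  have hq : f x - ((π (f x) : ℚ) : ℂ) = 0 := by
    refine uniq_aux (fun x => f x - ((π (f x) : ℚ) : ℂ)) ?_ ?_ ?_ x
    · have : f 0 = ((Fintype.card Rˣ : ℚ) : ℂ) := by simp [hf]
      simp only [this, hπ', sub_self]
    · intro x y h
      simp only [hfinv x y h]
    · intro x hx
      rw [Finset.sum_sub_distrib, hfs x hx, ← Rat.cast_sum, ← map_sum, hfs x hx]
      simp
  have hIntg : IsIntegral ℤ (f x) := by
    apply IsIntegral.sum
    intro u _
    apply IsIntegral.of_pow (n := Fintype.card R) Fintype.card_pos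
    rw [← AddChar.map_nsmul_eq_pow, card_nsmul_eq_zero, AddChar.map_zero_eq_one]
    exact isIntegral_one
  rw [sub_eq_zero] at hq
  rw [hq] at hIntg
  have h2 : IsIntegral ℤ (π (f x)) := by
    have : IsIntegral ℤ (algebraMap ℚ ℂ (π (f x))) := by simpa using hIntg
    exact (isIntegral_algebraMap_iff (algebraMap ℚ ℂ).injective).1 this
  obtain ⟨N, hN⟩ := IsIntegrallyClosed.isIntegral_iff.1 h2
  refine ⟨N, ?_⟩
  change f x = N
  rw [hq, ← hN]; simp

theorem w_eq {R : Type*} [Ring R] [Fintype R] [Fintype Rˣ] (χ : AddChar R ℂ)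
    (hχ : ∀ φ : AddChar R ℂ, ∃ r : R, ∀ x : R, φ x = χ (r * x))
    (w : R → ℝ) (γ : ℝ) (hw : IsHomWeight R w γ) (x : R) :
    (w x : ℂ) = γ - γ / (Nat.card Rˣ) * ∑ u : Rˣ, χ (x * u) := by
  classical
  obtain ⟨h0, hinv, hsum⟩ := hw
  rw [← sub_eq_zero]
  have hne : (Nat.card Rˣ : ℂ) ≠ 0 := Nat.cast_ne_zero.2 Nat.card_pos.ne'
  refine uniq_aux (fun x => (w x : ℂ) - (γ - γ / (Nat.card Rˣ) * ∑ u : Rˣ, χ (x * u))) ?_ ?_ ?_ x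
  · simp only [h0, zero_mul, AddChar.map_zero_eq_one, Finset.sum_const, Finset.card_univ,
      nsmul_eq_mul, mul_one, ← Nat.card_eq_fintype_card]
    field_simp
    simp
  · intro x y h
    obtain ⟨a, ha⟩ := span_eq_imp h
    obtain ⟨b, hb⟩ := span_eq_imp h.symm
    have h1 : ∑ u : Rˣ, χ (x * u) = ∑ u : Rˣ, χ (y * u) := by
      convert f_inv χ hχ x y a b ha hb
    simp only [hinv x y h, h1]
  · intro x hx
    have h1 : ∑ y with y ∈ Submodule.span R ({x} : Set R), ∑ u : Rˣ, χ (y * u) = 0 := by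
      convert f_sum χ hχ x hx
    rw [Finset.sum_sub_distrib, Finset.sum_sub_distrib, ← Finset.mul_sum, h1]
    have h2 := hsum x hx
    rw [finsum_mem_eq_toFinset_sum] at h2
    have e : (Submodule.span R ({x} : Set R) : Set R).toFinset =
        Finset.univ.filter (fun y => y ∈ Submodule.span R ({x} : Set R)) := by
      ext y; simp
    have e2 : Nat.card (Submodule.span R ({x} : Set R)) =
        (Finset.univ.filter (fun y => y ∈ Submodule.span R ({x} : Set R))).card := by
      rw [Nat.card_eq_fintype_card, Fintype.card_subtype]
    rw [e, e2] at h2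
    rw [← Complex.ofReal_sum, h2]
    simp [mul_comm]

theorem eig_integral {V : Type*} [Fintype V] (A : Matrix V V ℝ)
    (hA : ∀ a b, A a b = 1 ∨ A a b = 0) (ρ : ℝ) (v : V → ℝ) (hv : v ≠ 0)
    (h : A.mulVec v = ρ • v) : IsIntegral ℤ ρ := by
  classical
  let Z : Matrix V V ℤ := fun a b => if A a b = 1 then 1 else 0
  have hZ : A = Z.map (Int.castRingHom ℝ) := by
    ext a b
    rw [Matrix.map_apply]
    rcases hA a b with h | h <;> simp [Z, h]
  refine ⟨Z.charpoly, Z.charpoly_monic, ?_⟩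
  have h1 : (Matrix.scalar V ρ - A).det = 0 := by
    rw [← Matrix.exists_mulVec_eq_zero_iff]
    refine ⟨v, hv, ?_⟩
    rw [Matrix.sub_mulVec, h]
    ext a
    simp
  rw [← Matrix.eval_charpoly, hZ, Matrix.charpoly_map, Polynomial.eval_map] at h1
  exact h1

/-- spectral argument: the weighted sum of characters acts with eigenvalues `0` and `|C|`. -/
theorem spec_aux {R : Type*} [Ring R] [Fintype R] [Fintype Rˣ] (χ : AddChar R ℂ)
    (hχ : ∀ φ : AddChar R ℂ, ∃ r : R, ∀ x : R, φ x = χ (r * x))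
    (ℓ n : ℕ) (Y : Matrix (Fin ℓ) (Fin n) R)
    (C : Submodule R (Fin n → R)) [Fintype ↥C]
    (hC : (C : Set (Fin n → R)) = Set.range fun x : Fin ℓ → R => fun j => ∑ i, x i * Y i j)
    (hreg : ∀ j : Fin n, ∀ r : R, ∃ x : Fin ℓ → R, ∑ i, x i * Y i j = r)
    (hproj : ∀ j j' : Fin n,
      (Set.range fun r : R => fun i => Y i j * r)
        = (Set.range fun r : R => fun i => Y i j' * r) → j = j')
    (v : ↥C → ℂ) (hv : v ≠ 0) (μ : ℂ)
    (hμ : ∀ a : ↥C, ∑ b : ↥C, (∑ j, ∑ u : Rˣ, χ (((a : Fin n → R) - (b : Fin n → R)) j * u)) * v b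
      = μ * v a) : μ = 0 ∨ μ = Fintype.card C := by
  classical
  have horth : ∀ p q : Fin n × Rˣ,
      ∑ b : C, χ ((b : Fin n → R) p.1 * p.2 - (b : Fin n → R) q.1 * q.2) =
        if p = q then (Fintype.card C : ℂ) else 0 := by
    intro p q
    split_ifs with hpq
    · subst hpq; simp
    · have hne : ∃ b : C, χ ((b : Fin n → R) p.1 * p.2 - (b : Fin n → R) q.1 * q.2) ≠ 1 := by
        by_contra hcon
        push Not at hcon
        have h1 : ∀ b : C, (b : Fin n → R) p.1 * p.2 - (b : Fin n → R) q.1 * q.2 = 0 := by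
          intro b
          apply gen_left χ hχ
          intro t
          have := hcon (t • b)
          simpa [mul_sub, mul_assoc] using this
        have h2 : ∀ x : Fin ℓ → R, (∑ i, x i * Y i p.1) * p.2 = (∑ i, x i * Y i q.1) * q.2 := by
          intro x
          have hx : (fun j => ∑ i, x i * Y i j) ∈ C := by
            rw [← SetLike.mem_coe, hC]; exact ⟨x, rfl⟩
          exact sub_eq_zero.1 (h1 ⟨_, hx⟩)
        have h3 : ∀ i, Y i p.1 * p.2 = Y i q.1 * q.2 := by
          intro i
          simpa [Pi.single_apply] using h2 (Pi.single i 1)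
        have h4 : p.1 = q.1 := by
          apply hproj
          ext g
          constructor
          · rintro ⟨r, rfl⟩
            refine ⟨q.2 * (↑p.2⁻¹ * r), ?_⟩
            ext i
            simp only
            rw [← mul_assoc, ← h3 i, ← mul_assoc]; simp
          · rintro ⟨r, rfl⟩
            refine ⟨p.2 * (↑q.2⁻¹ * r), ?_⟩
            ext i
            simp only
            rw [← mul_assoc, h3 i, ← mul_assoc]; simp
        obtain ⟨x, hx⟩ := hreg p.1 1
        have h5 := h2 x
        rw [← h4, hx, one_mul, one_mul] at h5
        exact hpq (Prod.ext h4 (Units.ext h5))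
      obtain ⟨b, hb⟩ := hne
      refine sum_zero_of_translate _ _ b _ (by simp) ?_ hb
      intro s
      rw [← AddChar.map_add_eq_mul]
      congr 1
      simp only [Submodule.coe_add, Pi.add_apply, add_mul]
      abel
  let vh : Fin n × Rˣ → ℂ := fun p => ∑ b : C, χ (-((b : Fin n → R) p.1 * p.2)) * v b
  have h1 : ∀ a : C, ∑ p : Fin n × Rˣ, χ ((a : Fin n → R) p.1 * p.2) * vh p = μ * v a := by
    intro a
    rw [← hμ a]
    simp only [vh, Finset.mul_sum, Finset.sum_mul]
    rw [Finset.sum_comm]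
    refine Finset.sum_congr rfl fun b _ => ?_
    rw [Fintype.sum_prod_type]
    refine Finset.sum_congr rfl fun j _ => Finset.sum_congr rfl fun u _ => ?_
    rw [← mul_assoc, ← AddChar.map_add_eq_mul, Pi.sub_apply, sub_mul, sub_eq_add_neg]
  have h2 : ∀ q, μ * vh q = Fintype.card C * vh q := by
    intro q
    calc μ * vh q = ∑ a : C, χ (-((a : Fin n → R) q.1 * q.2)) * (μ * v a) := by
          simp only [vh, Finset.mul_sum]
          refine Finset.sum_congr rfl fun a _ => by ring
      _ = ∑ p, (∑ a : C, χ ((a : Fin n → R) p.1 * p.2 - (a : Fin n → R) q.1 * q.2)) * vh p := by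
          simp only [← h1, Finset.mul_sum, Finset.sum_mul]
          rw [Finset.sum_comm]
          refine Finset.sum_congr rfl fun p _ => Finset.sum_congr rfl fun a _ => ?_
          rw [sub_eq_add_neg, AddChar.map_add_eq_mul]; ring
      _ = _ := by
          simp [horth]
  by_cases hvh : ∃ q, vh q ≠ 0
  · obtain ⟨q, hq⟩ := hvh
    exact Or.inr (mul_right_cancel₀ hq (h2 q))
  · push Not at hvh
    left
    obtain ⟨a, ha⟩ := Function.ne_iff.1 hv
    have := h1 a
    simp only [hvh, mul_zero, Finset.sum_const_zero] at this
    exact (mul_eq_zero.1 this.symm).resolve_right ha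

open scoped Classical in
/-- Let `C ≤ R^n` be a proper, regular, projective two-weight code over a
finite Frobenius ring `R`, with nonzero homogeneous weights `w₁ < w₂` (average value `γ`).
If the Cayley graph `Γ(C)` (adjacency matrix `A`, connecting codewords at distance `w₁`)
has valency `k` and restricted eigenvalues `ρ₁ < ρ₂`, then
`ρ₂ − ρ₁` is a positive integer dividing `|C|`, and
`w₁ = γ|C|(ρ₁+1)/((ρ₁−ρ₂)|R^×|)`, `w₂ = γ|C|ρ₁/((ρ₁−ρ₂)|R^×|)`. -/
theorem stmt13 (R : Type*) [Ring R] [Fintype R]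
    (hF : IsFrobeniusRing R) (w : R → ℝ) (γ : ℝ) (hw : IsHomWeight R w γ)
    (ℓ n : ℕ) (Y : Matrix (Fin ℓ) (Fin n) R)
    (C : Submodule R (Fin n → R)) [Fintype ↥C]
    (hC : (C : Set (Fin n → R)) = Set.range fun x : Fin ℓ → R => fun j => ∑ i, x i * Y i j)
    (hreg : ∀ j : Fin n, ∀ r : R, ∃ x : Fin ℓ → R, ∑ i, x i * Y i j = r)
    (hproj : ∀ j j' : Fin n,
      (Set.range fun r : R => fun i => Y i j * r)
        = (Set.range fun r : R => fun i => Y i j' * r) → j = j')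
    (hproper : ∀ c ∈ C, wN w c = 0 → c = 0)
    (w₁ w₂ : ℝ) (hw₁pos : 0 < w₁) (hw₁₂ : w₁ < w₂)
    (htw : {x : ℝ | ∃ c ∈ C, c ≠ 0 ∧ wN w c = x} = {w₁, w₂})
    (A : Matrix ↥C ↥C ℝ)
    (hA : ∀ a b : ↥C, A a b = if wN w ((a : Fin n → R) - (b : Fin n → R)) = w₁ then 1 else 0)
    (k ρ₁ ρ₂ : ℝ)
    (hk : ∀ a : ↥C, ∑ b : ↥C, A a b = k)
    (hρ₁ : ∃ v : ↥C → ℝ, v ≠ 0 ∧ A.mulVec v = ρ₁ • v ∧ ∑ c : ↥C, v c = 0)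
    (hρ₂ : ∃ v : ↥C → ℝ, v ≠ 0 ∧ A.mulVec v = ρ₂ • v ∧ ∑ c : ↥C, v c = 0)
    (hρ : ρ₁ < ρ₂) :
    (∃ m : ℕ, 0 < m ∧ (ρ₂ - ρ₁ : ℝ) = m ∧ m ∣ Nat.card ↥C) ∧
    w₁ = γ * (Nat.card ↥C : ℝ) * (ρ₁ + 1) / ((ρ₁ - ρ₂) * (Nat.card Rˣ : ℝ)) ∧
    w₂ = γ * (Nat.card ↥C : ℝ) * ρ₁ / ((ρ₁ - ρ₂) * (Nat.card Rˣ : ℝ)) := by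
  classical
  have : Fintype Rˣ := Fintype.ofFinite _
  obtain ⟨χ, hχ⟩ := hF
  have hc0 : (0 : ℝ) < Nat.card Rˣ := Nat.cast_pos.2 Nat.card_pos
  have hCpos : (0 : ℝ) < Nat.card C := Nat.cast_pos.2 Nat.card_pos
  choose N hN using f_int χ hχ
  have hwN : ∀ x, w x = γ - γ / (Nat.card Rˣ) * N x := by
    intro x
    have := w_eq χ hχ w γ hw x
    rw [hN] at this
    exact_mod_cast this
  have hNle : ∀ x, (N x : ℝ) ≤ Nat.card Rˣ := by
    intro x
    have h1 : ‖∑ u : Rˣ, χ (x * u)‖ ≤ Nat.card Rˣ := by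
      refine (norm_sum_le _ _).trans ?_
      simp [Nat.card_eq_fintype_card]
    rw [hN, Complex.norm_intCast] at h1
    exact (le_abs_self _).trans h1
  have hW : ∀ c : Fin n → R, wN w c = γ / (Nat.card Rˣ) * ∑ j, ((Nat.card Rˣ : ℝ) - N (c j)) := by
    intro c
    simp only [wN, Finset.mul_sum]
    refine Finset.sum_congr rfl fun j _ => ?_
    rw [hwN]; field_simp
  have hm1 : w₁ ∈ ({w₁, w₂} : Set ℝ) := by simp
  have hm2 : w₂ ∈ ({w₁, w₂} : Set ℝ) := by simp
  rw [← htw] at hm1 hm2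
  obtain ⟨c₁, hc₁, hc₁0, hwc₁⟩ := hm1
  obtain ⟨c₂, hc₂, hc₂0, hwc₂⟩ := hm2
  have hγ : 0 < γ := by
    by_contra hcon
    push Not at hcon
    have h1 : wN w c₁ ≤ 0 := by
      rw [hW]
      apply mul_nonpos_of_nonpos_of_nonneg
      · exact div_nonpos_of_nonpos_of_nonneg hcon hc0.le
      · exact Finset.sum_nonneg fun j _ => sub_nonneg.2 (hNle _)
    linarith
  set δ := γ / (Nat.card Rˣ : ℝ) with hδ
  have hδ0 : 0 < δ := div_pos hγ hc0
  have hAW : ∀ a b : C, wN w ((a : Fin n → R) - (b : Fin n → R)) =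
      w₂ - w₂ * (if a = b then 1 else 0) - (w₂ - w₁) * A a b := by
    intro a b
    rw [hA]
    by_cases hab : a = b
    · subst hab
      have : wN w ((a : Fin n → R) - (a : Fin n → R)) = 0 := by simp [wN, hw.1]
      rw [this, if_neg hw₁pos.ne]; simp
    · have hm : wN w ((a : Fin n → R) - (b : Fin n → R)) ∈ ({w₁, w₂} : Set ℝ) := by
        rw [← htw]
        exact ⟨_, C.sub_mem a.2 b.2, sub_ne_zero.2 fun h => hab (Subtype.ext h), rfl⟩
      rcases hm with hm | hm
      · rw [if_neg hab, hm]; simp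
      · rw [Set.mem_singleton_iff] at hm
        rw [if_neg hab, hm, if_neg hw₁₂.ne']; simp
  have hspec : ∀ ρ : ℝ, (∃ v : ↥C → ℝ, v ≠ 0 ∧ A.mulVec v = ρ • v ∧ ∑ c : ↥C, v c = 0) →
      w₂ + (w₂ - w₁) * ρ = 0 ∨ w₂ + (w₂ - w₁) * ρ = δ * Nat.card C := by
    rintro ρ ⟨v, hv, hAv, hsv⟩
    have hAv' : ∀ a, ∑ b, A a b * v b = ρ * v a := fun a => congrFun hAv a
    have e1 : ∀ a : C, ∑ b : C, wN w ((a : Fin n → R) - (b : Fin n → R)) * v b =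
        -(w₂ + (w₂ - w₁) * ρ) * v a := by
      intro a
      have : ∀ b : C, wN w ((a : Fin n → R) - (b : Fin n → R)) * v b =
          w₂ * v b - w₂ * (if a = b then v b else 0) - (w₂ - w₁) * (A a b * v b) := by
        intro b
        rw [hAW]; split_ifs <;> ring
      simp only [this, Finset.sum_sub_distrib, ← Finset.mul_sum, hsv, hAv']
      simp; ring
    have e2 : ∀ a : C, ∑ b : C, (∑ j, (N (((a : Fin n → R) - (b : Fin n → R)) j) : ℝ)) * v b =
        (w₂ + (w₂ - w₁) * ρ) / δ * v a := by
      intro a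
      have h1 := e1 a
      have : ∀ b : C, wN w ((a : Fin n → R) - (b : Fin n → R)) * v b =
          δ * n * Nat.card Rˣ * v b - δ * ((∑ j, (N (((a : Fin n → R) - (b : Fin n → R)) j) : ℝ)) * v b) := by
        intro b
        rw [hW, Finset.sum_sub_distrib]
        simp only [Finset.sum_const, Finset.card_univ, Fintype.card_fin, nsmul_eq_mul]
        ring
      simp only [this, Finset.sum_sub_distrib, ← Finset.mul_sum, hsv, mul_zero, zero_sub] at h1
      rw [div_mul_eq_mul_div, eq_div_iff hδ0.ne']
      linarith
    have e3 := spec_aux χ hχ ℓ n Y C hC hreg hproj (fun a => (v a : ℂ))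
      (by
        obtain ⟨a, ha⟩ := Function.ne_iff.1 hv
        exact Function.ne_iff.2 ⟨a, by simpa using ha⟩)
      (((w₂ + (w₂ - w₁) * ρ) / δ : ℝ) : ℂ)
      (by
        intro a
        simp only [hN]
        exact_mod_cast e2 a)
    rcases e3 with e3 | e3
    · left
      have := Complex.ofReal_eq_zero.1 e3
      exact (div_eq_zero_iff.1 this).resolve_right hδ0.ne'
    · right
      have e4 : (w₂ + (w₂ - w₁) * ρ) / δ = Fintype.card C := by exact_mod_cast e3
      rw [div_eq_iff hδ0.ne'] at e4
      rw [e4, Nat.card_eq_fintype_card, mul_comm]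
  have hd : 0 < w₂ - w₁ := sub_pos.2 hw₁₂
  have hlt : (w₂ - w₁) * ρ₁ < (w₂ - w₁) * ρ₂ := mul_lt_mul_of_pos_left hρ hd
  have hδC : 0 < δ * Nat.card C := mul_pos hδ0 hCpos
  have r1 : w₂ + (w₂ - w₁) * ρ₁ = 0 := by
    rcases hspec ρ₁ hρ₁ with h | h
    · exact h
    · rcases hspec ρ₂ hρ₂ with h' | h' <;> linarith
  have r2 : w₂ + (w₂ - w₁) * ρ₂ = δ * Nat.card C := by
    rcases hspec ρ₂ hρ₂ with h | h
    · linarith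
    · exact h
  have r3 : (w₂ - w₁) * (ρ₂ - ρ₁) = δ * Nat.card C := by linarith
  have hρne : ρ₁ - ρ₂ ≠ 0 := (sub_neg.2 hρ).ne
  refine ⟨?_, ?_, ?_⟩
  · have hA01 : ∀ a b, A a b = 1 ∨ A a b = 0 := by
      intro a b; rw [hA]; split_ifs <;> simp
    have hIntg : ∀ ρ : ℝ, (∃ v : ↥C → ℝ, v ≠ 0 ∧ A.mulVec v = ρ • v ∧ ∑ c : ↥C, v c = 0) →
        IsIntegral ℤ ρ := by
      rintro ρ ⟨v, hv, hAv, _⟩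
      exact eig_integral A hA01 ρ v hv hAv
    have hi : IsIntegral ℤ (ρ₂ - ρ₁) := (hIntg _ hρ₂).sub (hIntg _ hρ₁)
    obtain ⟨D, hD⟩ : ∃ D : ℤ, w₂ - w₁ = δ * D := by
      refine ⟨∑ j, N (c₁ j) - ∑ j, N (c₂ j), ?_⟩
      rw [← hwc₁, ← hwc₂, hW, hW, Finset.sum_sub_distrib, Finset.sum_sub_distrib]
      push_cast
      ring
    have r4 : (D : ℝ) * (ρ₂ - ρ₁) = Nat.card C := by
      rw [hD, mul_assoc] at r3
      exact mul_left_cancel₀ hδ0.ne' r3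
    have hD0 : (D : ℝ) ≠ 0 := by
      intro h; rw [h, zero_mul] at r4; exact hCpos.ne r4
    have hq : ρ₂ - ρ₁ = (((Nat.card C : ℚ) / D : ℚ) : ℝ) := by
      push_cast
      rw [eq_div_iff hD0, mul_comm]; exact r4
    rw [hq] at hi
    have hi2 : IsIntegral ℤ ((Nat.card C : ℚ) / D : ℚ) := by
      have : IsIntegral ℤ (algebraMap ℚ ℝ ((Nat.card C : ℚ) / D : ℚ)) := by simpa using hi
      exact (isIntegral_algebraMap_iff (algebraMap ℚ ℝ).injective).1 this
    obtain ⟨m, hm⟩ := IsIntegrallyClosed.isIntegral_iff.1 hi2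
    rw [← hm] at hq
    have hq' : ρ₂ - ρ₁ = (m : ℝ) := by simpa using hq
    have hm0 : 0 < m := by
      have : (0 : ℝ) < m := by rw [← hq']; exact sub_pos.2 hρ
      exact_mod_cast this
    lift m to ℕ using hm0.le
    refine ⟨m, by exact_mod_cast hm0, by simpa using hq', ?_⟩
    rw [hq'] at r4
    have r5 : D * (m : ℤ) = (Nat.card C : ℤ) := by exact_mod_cast r4
    exact Int.natCast_dvd_natCast.1 ⟨D, by rw [← r5, mul_comm]⟩
  · rw [eq_div_iff (mul_ne_zero hρne hc0.ne')]
    have : δ * Nat.card Rˣ = γ := div_mul_cancel₀ _ hc0.ne'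
    rw [← this]
    have r6 : w₁ * (ρ₁ - ρ₂) * (w₂ - w₁) = δ * Nat.card C * (ρ₁ + 1) * (w₂ - w₁) := by
      linear_combination (-w₁) * r3 - δ * Nat.card C * r1
    linear_combination (Nat.card Rˣ : ℝ) * mul_right_cancel₀ hd.ne' r6
  · rw [eq_div_iff (mul_ne_zero hρne hc0.ne')]
    have : δ * Nat.card Rˣ = γ := div_mul_cancel₀ _ hc0.ne'
    rw [← this]
    have r6 : w₂ * (ρ₁ - ρ₂) * (w₂ - w₁) = δ * Nat.card C * ρ₁ * (w₂ - w₁) := by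
      linear_combination (-w₂) * r3 - δ * Nat.card C * r1
    linear_combination (Nat.card Rˣ : ℝ) * mul_right_cancel₀ hd.ne' r6
end

section
/- Let C be a proper, regular, projective two-weight code over a finite Frobenius ring R with nonzero homogeneous weights w₁ < w₂ computed with γ = |R^×|. Then there exists a positive integer d dividing |C| and a positive integer t such that w₁ = d·t and w₂ = d·(t+1). -/
namespace FrobAux

open Finset

/-- Uniqueness principle. -/
lemma hom_mem {R : Type*} [Ring R] [Fintype R] (V : Submodule ℚ ℂ) (g : R → ℂ)
    (h0 : g 0 ∈ V)
    (hinv : ∀ x y : R, Submodule.span R ({x} : Set R) = Submodule.span R {y} → g x = g y)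
    (hs : ∀ x : R, x ≠ 0 →
      ∑ᶠ y ∈ (Submodule.span R ({x} : Set R) : Set R), g y ∈ V) (x : R) : g x ∈ V := by
  classical
  have key : ∀ m : ℕ, ∀ x : R, Nat.card (Submodule.span R ({x} : Set R)) = m → g x ∈ V := by
    intro m
    induction m using Nat.strong_induction_on with
    | _ m ih =>
      intro x hx
      by_cases hx0 : x = 0
      · rw [hx0]; exact h0
      have h := hs x hx0
      have e : ∑ᶠ y ∈ (Submodule.span R ({x} : Set R) : Set R), g y
          = ∑ y ∈ univ.filter (fun y => y ∈ Submodule.span R ({x} : Set R)), g y := by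
        rw [finsum_mem_def, finsum_eq_sum_of_fintype, Finset.sum_filter]
        refine Finset.sum_congr rfl fun y _ => ?_
        simp [Set.indicator_apply]
      rw [e, ← Finset.sum_filter_add_sum_filter_not _
        (fun y => Submodule.span R ({y} : Set R) = Submodule.span R ({x} : Set R))] at h
      have h2 : ∑ y ∈ (univ.filter (fun y => y ∈ Submodule.span R ({x} : Set R))).filter
          (fun y => ¬ Submodule.span R ({y} : Set R) = Submodule.span R ({x} : Set R)), g y ∈ V := by
        refine Submodule.sum_mem _ fun y hy => ?_
        simp only [mem_filter, mem_univ, true_and] at hy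
        have hle : Submodule.span R ({y} : Set R) ≤ Submodule.span R ({x} : Set R) := by
          rw [Submodule.span_singleton_le_iff_mem]; exact hy.1
        have hlt := lt_of_le_of_ne hle hy.2
        refine ih _ ?_ y rfl
        rw [← hx]
        exact Set.Finite.card_lt_card (Set.toFinite _) hlt
      have h3 := (V.add_mem_iff_left h2).1 h
      rw [Finset.sum_congr rfl (g := fun _ => g x)
        (fun y hy => hinv _ _ (Finset.mem_filter.1 hy).2), Finset.sum_const] at h3
      set k := ((univ.filter (fun y => y ∈ Submodule.span R ({x} : Set R))).filter
          (fun y => Submodule.span R ({y} : Set R) = Submodule.span R ({x} : Set R))).card with hk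
      have hkpos : k ≠ 0 := by
        rw [hk]
        refine Finset.card_ne_zero_of_mem (a := x) ?_
        simp [Submodule.mem_span_singleton_self]
      have h4 := V.smul_mem ((k : ℚ)⁻¹) h3
      have h5 : ((k : ℚ)⁻¹) • (k • g x) = g x := by
        rw [← Nat.cast_smul_eq_nsmul ℚ, smul_smul, inv_mul_cancel₀ (by exact_mod_cast hkpos), one_smul]
      rwa [h5] at h4
  exact key _ x rfl

lemma left_nondeg {R : Type*} [Ring R] [Fintype R] (χ : AddChar R ℂ)
    (hχ : ∀ φ : AddChar R ℂ, ∃ r : R, ∀ x : R, φ x = χ (r * x)) (r : R)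
    (h : ∀ x, χ (x * r) = 1) : r = 0 := by
  by_contra hr
  obtain ⟨φ, hφ⟩ := AddChar.exists_apply_ne_zero.2 hr
  obtain ⟨s, hs⟩ := hχ φ
  exact hφ (by rw [hs, h])

lemma right_nondeg {R : Type*} [Ring R] [Fintype R] (χ : AddChar R ℂ)
    (hχ : ∀ φ : AddChar R ℂ, ∃ r : R, ∀ x : R, φ x = χ (r * x)) (r : R)
    (h : ∀ x, χ (r * x) = 1) : r = 0 := by
  classical
  let F : R → AddChar R ℂ := fun r => AddChar.compAddMonoidHom χ (AddMonoidHom.mulLeft r)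
  have hF : Function.Surjective F := by
    intro φ
    obtain ⟨r, hr⟩ := hχ φ
    refine ⟨r, ?_⟩
    ext x
    simp [F, hr]
  have hb : Function.Bijective F := by
    rw [Fintype.bijective_iff_surjective_and_card]
    refine ⟨hF, ?_⟩
    exact (AddChar.card_eq (α := R)).symm
  apply hb.1
  ext x
  simp [F, h]

/-- Sum of a character along a left translate-closed set vanishes. -/
lemma sum_zero {R : Type*} [AddCommGroup R] (s : Finset R) (φ : AddChar R ℂ) (a : R)
    (hs : ∀ r, r ∈ s ↔ a + r ∈ s) (ha : φ a ≠ 1) : ∑ r ∈ s, φ r = 0 := by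
  have h : ∑ r ∈ s, φ r = ∑ r ∈ s, φ (a + r) := by
    symm
    refine Finset.sum_bij (fun r _ => a + r) (fun r hr => (hs r).1 hr)
      (fun r _ r' _ e => add_left_cancel e) (fun b hb => ⟨-a + b, ?_, by simp⟩) (fun _ _ => rfl)
    rw [hs]; simpa using hb
  simp only [AddChar.map_add_eq_mul, ← Finset.mul_sum] at h
  have : (φ a - 1) * ∑ r ∈ s, φ r = 0 := by rw [sub_mul, ← h]; ring
  exact (mul_eq_zero.1 this).resolve_left (sub_ne_zero.2 ha)

lemma unit_sum_inv {R : Type*} [Ring R] [Fintype R] (χ : AddChar R ℂ)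
    (hχ : ∀ φ : AddChar R ℂ, ∃ r : R, ∀ x : R, φ x = χ (r * x)) (x y : R)
    (hxy : Submodule.span R ({x} : Set R) = Submodule.span R {y}) [Fintype Rˣ] :
    ∑ u : Rˣ, χ (x * u) = ∑ u : Rˣ, χ (y * u) := by
  classical
  let P : R → Finset R := fun r => univ.image (fun t => r * t)
  have hPmem : ∀ r z, r ∈ P z ↔ P r ⊆ P z := by
    intro r z
    constructor
    · intro h s hs
      simp only [P, mem_image, mem_univ, true_and] at h hs ⊢
      obtain ⟨t, rfl⟩ := h
      obtain ⟨t', rfl⟩ := hs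
      exact ⟨t * t', by rw [mul_assoc]⟩
    · intro h
      apply h
      simp only [P, mem_image, mem_univ, true_and]
      exact ⟨1, mul_one r⟩
  have hann : ∀ z, x * z = 0 ↔ y * z = 0 := by
    intro z
    have hx : x ∈ Submodule.span R ({y} : Set R) := hxy ▸ Submodule.mem_span_singleton_self x
    have hy : y ∈ Submodule.span R ({x} : Set R) := hxy ▸ Submodule.mem_span_singleton_self y
    obtain ⟨a, ha⟩ := Submodule.mem_span_singleton.1 hx
    obtain ⟨b, hb⟩ := Submodule.mem_span_singleton.1 hy
    rw [smul_eq_mul] at ha hb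
    constructor
    · intro h; rw [← hb, mul_assoc, h, mul_zero]
    · intro h; rw [← ha, mul_assoc, h, mul_zero]
  have hideal : ∀ x z, ∑ r ∈ P z, χ (x * r) = if x * z = 0 then ((P z).card : ℂ) else 0 := by
    intro x z
    split_ifs with h
    · rw [Finset.sum_congr rfl (g := fun _ => (1 : ℂ))]
      · simp
      · intro r hr
        simp only [P, mem_image, mem_univ, true_and] at hr
        obtain ⟨t, rfl⟩ := hr
        rw [← mul_assoc, h, zero_mul, AddChar.map_zero_eq_one]
    · have : ∃ t, χ (x * z * t) ≠ 1 := by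
        by_contra! hc
        exact h (right_nondeg χ hχ _ hc)
      obtain ⟨t, ht⟩ := this
      refine sum_zero (P z) (AddChar.compAddMonoidHom χ (AddMonoidHom.mulLeft x)) (z * t) ?_ ?_
      · intro r
        simp only [P, mem_image, mem_univ, true_and]
        constructor
        · rintro ⟨s, rfl⟩; exact ⟨t + s, by rw [mul_add]⟩
        · rintro ⟨s, hs⟩; exact ⟨s - t, by rw [mul_sub, hs]; abel⟩
      · simpa [mul_assoc] using ht
  have hG : ∀ I : Finset R, ∑ r ∈ univ.filter (fun r => P r = I), χ (x * r)
      = ∑ r ∈ univ.filter (fun r => P r = I), χ (y * r) := by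
    intro I
    induction I using Finset.strongInduction with
    | _ I ih =>
      by_cases hI : ∃ z, P z = I
      · obtain ⟨z, rfl⟩ := hI
        have hdec : ∀ x, ∑ r ∈ P z, χ (x * r) = ∑ r ∈ univ.filter (fun r => P r = P z), χ (x * r)
            + ∑ J ∈ (P z).ssubsets, ∑ r ∈ univ.filter (fun r => P r = J), χ (x * r) := by
          intro x
          have h1 : ∑ r ∈ P z, χ (x * r)
              = ∑ J ∈ (P z).powerset, ∑ r ∈ (P z).filter (fun r => P r = J), χ (x * r) := by
            rw [Finset.sum_fiberwise_of_maps_to]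
            intro r hr
            exact Finset.mem_powerset.2 ((hPmem r z).1 hr)
          have h2 : ∀ J ∈ (P z).powerset, ∑ r ∈ (P z).filter (fun r => P r = J), χ (x * r)
              = ∑ r ∈ univ.filter (fun r => P r = J), χ (x * r) := by
            intro J hJ
            refine Finset.sum_congr ?_ fun _ _ => rfl
            ext r
            simp only [mem_filter, mem_univ, true_and, and_iff_right_iff_imp]
            rintro rfl
            exact (hPmem r z).2 (Finset.mem_powerset.1 hJ)
          rw [h1, Finset.sum_congr rfl h2, Finset.ssubsets,
            Finset.add_sum_erase _ (fun J => ∑ r ∈ univ.filter (fun r => P r = J), χ (x * r))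
              (Finset.mem_powerset.2 (Finset.Subset.refl _))]
        have hx := hdec x
        have hy := hdec y
        rw [hideal] at hx hy
        rw [Finset.sum_congr rfl (fun J hJ => ih J (Finset.mem_ssubsets.1 hJ))] at hx
        simp only [hann z] at hx
        rw [hx] at hy
        exact add_right_cancel hy
      · push Not at hI
        rw [Finset.filter_false_of_mem (fun r _ => hI r)]
        simp
  have hunits : ∀ x, ∑ u : Rˣ, χ (x * u) = ∑ r ∈ univ.filter (fun r => P r = univ), χ (x * r) := by
    intro x
    refine Finset.sum_bij (fun u _ => (u : R)) ?_ ?_ ?_ ?_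
    · intro u _
      simp only [mem_filter, mem_univ, true_and, P]
      rw [Finset.eq_univ_iff_forall]
      intro r
      simp only [mem_image, mem_univ, true_and]
      exact ⟨(u⁻¹ : Rˣ) * r, by simp⟩
    · intro u _ v _ h; exact Units.ext h
    · intro r hr
      simp only [mem_filter, mem_univ, true_and] at hr
      have h1 : (1 : R) ∈ P r := by rw [hr]; exact mem_univ _
      simp only [P, mem_image, mem_univ, true_and] at h1
      obtain ⟨s, hs⟩ := h1
      have : IsUnit r := IsUnit.of_mul_eq_one s hs
      exact ⟨this.unit, mem_univ _, rfl⟩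
    · intro _ _; rfl
  rw [hunits, hunits, hG]

lemma weight_formula {R : Type*} [Ring R] [Fintype R] (χ : AddChar R ℂ)
    (hχ : ∀ φ : AddChar R ℂ, ∃ r : R, ∀ x : R, φ x = χ (r * x)) [Fintype Rˣ]
    (w : R → ℝ) (hw : IsHomWeight R w (Nat.card Rˣ : ℝ)) (x : R) :
    (w x : ℂ) = (Nat.card Rˣ : ℂ) - ∑ u : Rˣ, χ (x * u) := by
  classical
  obtain ⟨hw0, hw1, hw2⟩ := hw
  have := hom_mem (⊥ : Submodule ℚ ℂ)
    (fun x => (w x : ℂ) - ((Nat.card Rˣ : ℂ) - ∑ u : Rˣ, χ (x * u))) ?_ ?_ ?_ x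
  · rw [Submodule.mem_bot] at this
    exact sub_eq_zero.1 this
  · simp [hw0]
  · intro x y h
    simp only [hw1 x y h, unit_sum_inv χ hχ x y h]
  · intro x hx
    have h := hw2 x hx
    rw [Submodule.mem_bot]
    have conv1 : ∀ {A : Type} [AddCommMonoid A] (g : R → A),
        ∑ᶠ y ∈ (Submodule.span R ({x} : Set R) : Set R), g y
          = ∑ y ∈ univ.filter (fun y => y ∈ Submodule.span R ({x} : Set R)), g y := by
      intro A _ g
      rw [finsum_mem_def, finsum_eq_sum_of_fintype, Finset.sum_filter]
      refine Finset.sum_congr rfl fun y _ => ?_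
      simp [Set.indicator_apply]
    rw [conv1] at h ⊢
    have h' := congrArg (fun a : ℝ => (a : ℂ)) h
    simp only [Complex.ofReal_sum, Complex.ofReal_mul, Complex.ofReal_natCast] at h'
    rw [Finset.sum_sub_distrib, h', Finset.sum_sub_distrib, Finset.sum_comm, Finset.sum_const,
      Finset.sum_eq_zero (s := (univ : Finset Rˣ))]
    · have : (univ.filter (fun y => y ∈ Submodule.span R ({x} : Set R))).card
          = Nat.card (Submodule.span R ({x} : Set R)) := by
        rw [Nat.card_eq_fintype_card, Fintype.card_subtype]
      rw [this, nsmul_eq_mul]; ring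
    · intro u _
      have hex : ∃ t, χ (t * (x * u)) ≠ 1 := by
        by_contra! hc
        have := left_nondeg χ hχ _ hc
        exact hx (by simpa using this)
      obtain ⟨t, ht⟩ := hex
      refine sum_zero _ (AddChar.compAddMonoidHom χ (AddMonoidHom.mulRight (u : R))) (t * x) ?_ ?_
      · intro r
        simp only [mem_filter, mem_univ, true_and]
        rw [Submodule.add_mem_iff_right]
        exact Submodule.mem_span_singleton.2 ⟨t, rfl⟩
      · simpa [mul_assoc] using ht

lemma weight_rat {R : Type*} [Ring R] [Fintype R] 
    (w : R → ℝ) (hw : IsHomWeight R w (Nat.card Rˣ : ℝ)) (x : R) :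
    ∃ q : ℚ, (w x : ℂ) = q := by
  classical
  obtain ⟨hw0, hw1, hw2⟩ := hw
  have := hom_mem (Submodule.span ℚ ({1} : Set ℂ)) (fun x => (w x : ℂ)) ?_ ?_ ?_ x
  · obtain ⟨q, hq⟩ := Submodule.mem_span_singleton.1 this
    exact ⟨q, by rw [← hq, Rat.smul_one_eq_cast]⟩
  · simp [hw0]
  · intro x y h
    simp only [hw1 x y h]
  · intro x hx
    have h := congrArg (fun a : ℝ => (a : ℂ)) (hw2 x hx)
    have e : ∑ᶠ y ∈ (Submodule.span R ({x} : Set R) : Set R), (w y : ℂ)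
        = ((∑ᶠ y ∈ (Submodule.span R ({x} : Set R) : Set R), w y : ℝ) : ℂ) := by
      exact (AddMonoidHom.map_finsum_mem w (Complex.ofRealHom : ℝ →+ ℂ) (Set.toFinite _)).symm
    rw [e, h]
    refine Submodule.mem_span_singleton.2 ⟨(Nat.card Rˣ : ℚ) * Nat.card (Submodule.span R ({x} : Set R)), ?_⟩
    rw [Rat.smul_one_eq_cast]; push_cast; rfl

lemma int_of_integral {z : ℂ} (hz : IsIntegral ℤ z) (q : ℚ) (hq : z = q) : ∃ k : ℤ, z = k := by
  have h1 : IsIntegral ℤ (algebraMap ℚ ℂ q) := by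
    rw [eq_ratCast, ← hq]; exact hz
  have h2 := (isIntegral_algebraMap_iff (algebraMap ℚ ℂ).injective).1 h1
  obtain ⟨k, hk⟩ := IsIntegrallyClosed.isIntegral_iff.1 h2
  refine ⟨k, ?_⟩
  rw [hq, ← hk]; simp

lemma char_integral {G : Type*} [AddCommGroup G] [Fintype G] (ψ : AddChar G ℂ) (c : G) :
    IsIntegral ℤ (ψ c) := by
  refine IsIntegral.of_pow (n := Fintype.card G) Fintype.card_pos ?_
  rw [← AddChar.map_nsmul_eq_pow, card_nsmul_eq_zero, AddChar.map_zero_eq_one]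
  exact isIntegral_one

lemma abs_lemma {G J : Type*} [AddCommGroup G] [Fintype G] [Fintype J]
    (ψ : J → AddChar G ℂ) (hinj : Function.Injective ψ) (hne : ∀ j, ψ j ≠ 0)
    (W : G → ℝ) (hW : ∀ c, (W c : ℂ) = (Fintype.card J : ℂ) - ∑ j, ψ j c)
    (hrat : ∀ c, ∃ q : ℚ, (W c : ℂ) = q)
    (w₁ w₂ : ℝ) (hw₁pos : 0 < w₁) (hw₁₂ : w₁ < w₂)
    (h1 : ∃ c, c ≠ 0 ∧ W c = w₁) (h2 : ∃ c, c ≠ 0 ∧ W c = w₂)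
    (h12 : ∀ c, c ≠ 0 → W c = w₁ ∨ W c = w₂) :
    ∃ d t : ℕ, 0 < d ∧ 0 < t ∧ d ∣ Nat.card G ∧
      w₁ = (d : ℝ) * t ∧ w₂ = (d : ℝ) * (t + 1) := by
  classical
  have hint : ∀ c, ∃ k : ℤ, W c = k := by
    intro c
    obtain ⟨q, hq⟩ := hrat c
    obtain ⟨k, hk⟩ := int_of_integral (z := (W c : ℂ)) (by
      rw [hW]
      refine IsIntegral.sub ?_ (IsIntegral.sum _ fun j _ => char_integral _ _)
      exact_mod_cast isIntegral_algebraMap (R := ℤ) (A := ℂ) (x := (Fintype.card J : ℤ))) q hq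
    exact ⟨k, by exact_mod_cast hk⟩
  obtain ⟨c₁, hc₁, hc₁w⟩ := h1
  obtain ⟨c₂, hc₂, hc₂w⟩ := h2
  obtain ⟨a, ha⟩ := hint c₁
  obtain ⟨b, hb⟩ := hint c₂
  rw [hc₁w] at ha
  rw [hc₂w] at hb
  have hW0 : W 0 = 0 := by
    have := hW 0
    simp at this
    exact this
  have hab : a < b := by rw [ha, hb] at hw₁₂; exact_mod_cast hw₁₂
  have ha0 : 0 < a := by rw [ha] at hw₁pos; exact_mod_cast hw₁pos
  have hJ : Nonempty J := by
    by_contra hJ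
    rw [not_nonempty_iff] at hJ
    have := hW c₁
    simp at this
    linarith
  have hex : ∃ φ : AddChar G ℂ, φ ≠ 0 ∧ ∀ j, ψ j ≠ φ := by
    by_contra! hc
    have hconst : ∀ c, c ≠ 0 → (W c : ℂ) = Fintype.card J + 1 := by
      intro c hc0
      have hs : ∑ j, ψ j c = ∑ φ ∈ univ.erase (0 : AddChar G ℂ), φ c := by
        refine Finset.sum_bij (fun j _ => ψ j) ?_ ?_ ?_ ?_
        · intro j _; simp [hne j]
        · intro j _ j' _ h; exact hinj h
        · intro φ hφ
          obtain ⟨j, hj⟩ := hc φ (Finset.ne_of_mem_erase hφ)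
          exact ⟨j, mem_univ _, hj⟩
        · intro _ _; rfl
      have hs2 := Finset.add_sum_erase univ (fun φ : AddChar G ℂ => φ c) (mem_univ 0)
      rw [AddChar.sum_apply_eq_ite, if_neg hc0, AddChar.zero_apply] at hs2
      rw [hW, hs]
      linear_combination -hs2
    have := (hconst c₁ hc₁).trans (hconst c₂ hc₂).symm
    rw [hc₁w, hc₂w] at this
    have : w₁ = w₂ := by exact_mod_cast this
    linarith
  let D : AddChar G ℂ → ℂ := fun φ => ∑ c ∈ univ.filter (fun c => c ≠ 0 ∧ W c = w₁), φ (-c)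
  have hD : ∀ φ, IsIntegral ℤ (D φ) := fun φ => IsIntegral.sum _ fun c _ => char_integral _ _
  have hWdec : ∀ c, (W c : ℂ) = b - (b - a) * (if c ≠ 0 ∧ W c = w₁ then 1 else 0)
      - b * (if c = 0 then 1 else 0) := by
    intro c
    by_cases h0 : c = 0
    · subst h0; simp [hW0]
    · rcases h12 c h0 with h | h
      · simp [h0, h, ha]
      · have : w₂ ≠ w₁ := hw₁₂.ne'
        rw [h, if_neg (fun h' => this h'.2), if_neg h0, hb]
        simp
  have hsumneg : ∀ φ : AddChar G ℂ, φ ≠ 0 → ∑ c, φ (-c) = 0 := by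
    intro φ hφ
    rw [← AddChar.sum_eq_zero_iff_ne_zero] at hφ
    rw [← hφ]
    exact Fintype.sum_equiv (Equiv.neg G) _ _ (fun c => rfl)
  have hfour : ∀ φ : AddChar G ℂ, φ ≠ 0 → (b - a : ℂ) * D φ + b
      = ∑ j, if ψ j = φ then (Fintype.card G : ℂ) else 0 := by
    intro φ hφ
    have e1 : ∑ c, (W c : ℂ) * φ (-c) = - ((b - a : ℂ) * D φ + b) := by
      have : ∀ c, (W c : ℂ) * φ (-c) = b * φ (-c)
          - (b - a) * (if c ≠ 0 ∧ W c = w₁ then φ (-c) else 0)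
          - b * (if c = 0 then φ (-c) else 0) := by
        intro c
        conv_lhs => rw [hWdec c]
        split_ifs <;> ring
      rw [Finset.sum_congr rfl fun c _ => this c, Finset.sum_sub_distrib, Finset.sum_sub_distrib,
        ← Finset.mul_sum, ← Finset.mul_sum, ← Finset.mul_sum, hsumneg φ hφ, ← Finset.sum_filter,
        Finset.sum_ite_eq']
      simp [D]
      ring
    have e2 : ∑ c, (W c : ℂ) * φ (-c) = - ∑ j, if ψ j = φ then (Fintype.card G : ℂ) else 0 := by
      simp only [hW, sub_mul, Finset.sum_sub_distrib]
      rw [← Finset.mul_sum, hsumneg φ hφ, mul_zero, zero_sub]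
      congr 1
      simp only [Finset.sum_mul]
      rw [Finset.sum_comm]
      refine Finset.sum_congr rfl fun j _ => ?_
      have : ∀ c, ψ j c * φ (-c) = (ψ j - φ) c := by
        intro c; rw [AddChar.sub_apply]
      simp only [this]
      rw [AddChar.sum_eq_ite]
      simp [sub_eq_zero]
    rw [e2] at e1
    exact (neg_injective e1).symm
  have hdne : (b - a : ℂ) ≠ 0 := by
    have : ((b - a : ℤ) : ℂ) ≠ 0 := by exact_mod_cast (sub_pos.2 hab).ne'
    simpa using this
  obtain ⟨φ, hφ0, hφ⟩ := hex
  have f1 := hfour φ hφ0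
  rw [Finset.sum_eq_zero (fun j _ => if_neg (hφ j))] at f1
  obtain ⟨j₀⟩ := hJ
  have f2 := hfour (ψ j₀) (hne j₀)
  simp only [hinj.eq_iff] at f2
  rw [Finset.sum_ite_eq' univ j₀, if_pos (mem_univ _)] at f2
  obtain ⟨k, hk⟩ := int_of_integral (hD φ) (-b / (b - a)) (by
    push_cast; rw [eq_div_iff hdne]; linear_combination f1)
  obtain ⟨m, hm⟩ := int_of_integral (hD (ψ j₀)) ((Fintype.card G - b) / (b - a)) (by
    push_cast; rw [eq_div_iff hdne]; linear_combination f2)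
  rw [hk] at f1
  rw [hm] at f2
  have g1 : (b - a) * k + b = 0 := by exact_mod_cast f1
  have g2 : (b - a) * m + b = Fintype.card G := by exact_mod_cast f2
  have hd : 0 < b - a := sub_pos.2 hab
  obtain ⟨d, hd'⟩ := Int.eq_ofNat_of_zero_le hd.le
  have ht : 0 < -k - 1 := by
    by_contra hneg
    have : (b - a) * (-k - 1) ≤ 0 := mul_nonpos_of_nonneg_of_nonpos hd.le (not_lt.1 hneg)
    nlinarith
  obtain ⟨t, ht'⟩ := Int.eq_ofNat_of_zero_le ht.le
  have hat : a = d * t := by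
    rw [← ht', ← hd']; linear_combination g1
  have hbt : b = d * (t + 1) := by
    rw [← ht', ← hd']; linear_combination g1
  refine ⟨d, t, by omega, by omega, ?_, ?_, ?_⟩
  · rw [Nat.card_eq_fintype_card]
    have : (d : ℤ) ∣ (Fintype.card G : ℤ) := ⟨m - k, by
      rw [← hd']; linear_combination -g2 + g1⟩
    exact_mod_cast this
  · rw [ha, hat]; push_cast; rfl
  · rw [hb, hbt]; push_cast; rfl

end FrobAux

/-- Let `C ≤ R^n` be a proper, regular, projective two-weight code over a
finite Frobenius ring `R`, with nonzero homogeneous weights `w₁ < w₂` computed with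
`γ = |R^×|`.  Then there exist a positive integer `d` dividing `|C|` and a positive
integer `t` with `w₁ = d·t` and `w₂ = d·(t+1)`. -/
theorem stmt14 (R : Type*) [Ring R] [Fintype R]
    (hF : IsFrobeniusRing R) (w : R → ℝ) (hw : IsHomWeight R w (Nat.card Rˣ : ℝ))
    (ℓ n : ℕ) (Y : Matrix (Fin ℓ) (Fin n) R)
    (C : Submodule R (Fin n → R)) [Fintype ↥C]
    (hC : (C : Set (Fin n → R)) = Set.range fun x : Fin ℓ → R => fun j => ∑ i, x i * Y i j)
    (hreg : ∀ j : Fin n, ∀ r : R, ∃ x : Fin ℓ → R, ∑ i, x i * Y i j = r)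
    (hproj : ∀ j j' : Fin n,
      (Set.range fun r : R => fun i => Y i j * r)
        = (Set.range fun r : R => fun i => Y i j' * r) → j = j')
    (hproper : ∀ c ∈ C, wN w c = 0 → c = 0)
    (w₁ w₂ : ℝ) (hw₁pos : 0 < w₁) (hw₁₂ : w₁ < w₂)
    (htw : {x : ℝ | ∃ c ∈ C, c ≠ 0 ∧ wN w c = x} = {w₁, w₂})
    :
    ∃ d t : ℕ, 0 < d ∧ 0 < t ∧ d ∣ Nat.card ↥C ∧
      w₁ = (d : ℝ) * t ∧ w₂ = (d : ℝ) * (t + 1) := by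
  classical
  obtain ⟨χ, hχ⟩ := hF
  have hset1 : w₁ ∈ {x : ℝ | ∃ c ∈ C, c ≠ 0 ∧ wN w c = x} := by rw [htw]; simp
  have hset2 : w₂ ∈ {x : ℝ | ∃ c ∈ C, c ≠ 0 ∧ wN w c = x} := by rw [htw]; simp
  obtain ⟨c₁, hc₁C, hc₁, hc₁w⟩ := hset1
  obtain ⟨c₂, hc₂C, hc₂, hc₂w⟩ := hset2
  have hnt : (1 : R) ≠ 0 := by
    intro h
    apply hc₁
    funext i
    exact (mul_one (c₁ i)).symm.trans (by rw [h, mul_zero]; rfl)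
  have hmem : ∀ x : Fin ℓ → R, (fun j => ∑ i, x i * Y i j) ∈ C := by
    intro x
    have : (fun j => ∑ i, x i * Y i j) ∈ (C : Set (Fin n → R)) := by
      rw [hC]; exact ⟨x, rfl⟩
    exact this
  let ψ : Fin n × Rˣ → AddChar C ℂ := fun p =>
    AddChar.compAddMonoidHom χ ((AddMonoidHom.mulRight (p.2 : R)).comp
      ((Pi.evalAddMonoidHom (fun _ : Fin n => R) p.1).comp C.subtype.toAddMonoidHom))
  have hψ : ∀ p c, ψ p c = χ ((c : Fin n → R) p.1 * (p.2 : R)) := fun p c => rfl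
  refine FrobAux.abs_lemma (G := C) ψ ?_ ?_ (fun c => wN w (c : Fin n → R)) ?_ ?_ w₁ w₂
    hw₁pos hw₁₂ ⟨⟨c₁, hc₁C⟩, fun h => hc₁ (congrArg Subtype.val h), hc₁w⟩
    ⟨⟨c₂, hc₂C⟩, fun h => hc₂ (congrArg Subtype.val h), hc₂w⟩ ?_
  · rintro ⟨j, u⟩ ⟨j', u'⟩ h
    have hcol : ∀ i, Y i j * u = Y i j' * u' := by
      intro i
      rw [← sub_eq_zero]
      apply FrobAux.left_nondeg χ hχ
      intro t
      have h1 := DFunLike.congr_fun h ⟨_, hmem (Pi.single i t)⟩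
      simp only [hψ, Pi.single_apply, ite_mul, zero_mul, Finset.sum_ite_eq', Finset.mem_univ,
        if_true] at h1
      rw [mul_sub, AddChar.map_sub_eq_div, ← mul_assoc, ← mul_assoc, h1]
      exact div_self (χ.val_isUnit _).ne_zero
    have hj : j = j' := by
      apply hproj
      ext v
      simp only [Set.mem_range]
      constructor
      · rintro ⟨r, rfl⟩
        refine ⟨u' * ((u⁻¹ : Rˣ) * r), funext fun i => ?_⟩
        rw [← mul_assoc, ← hcol, mul_assoc, Units.mul_inv_cancel_left]
      · rintro ⟨r, rfl⟩
        refine ⟨u * ((u'⁻¹ : Rˣ) * r), funext fun i => ?_⟩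
        rw [← mul_assoc, hcol, mul_assoc, Units.mul_inv_cancel_left]
    subst hj
    obtain ⟨x, hx⟩ := hreg j 1
    have hu : (u : R) = u' := by
      rw [← one_mul (u : R), ← one_mul (u' : R), ← hx, Finset.sum_mul, Finset.sum_mul]
      refine Finset.sum_congr rfl fun i _ => ?_
      rw [mul_assoc, hcol, mul_assoc]
    rw [Units.ext hu]
  · rintro ⟨j, u⟩ h
    apply hnt
    apply FrobAux.left_nondeg χ hχ
    intro t
    obtain ⟨x, hx⟩ := hreg j (t * (u⁻¹ : Rˣ))
    have h1 := DFunLike.congr_fun h ⟨_, hmem x⟩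
    rw [hψ] at h1
    simp only [hx, AddChar.zero_apply] at h1
    simpa using h1
  · intro c
    have : ∀ i, (w ((c : Fin n → R) i) : ℂ) = _ := fun i => FrobAux.weight_formula χ hχ w hw _
    simp only [wN, Complex.ofReal_sum, this, hψ, Finset.sum_sub_distrib, Fintype.sum_prod_type]
    simp [Nat.card_eq_fintype_card]
  · intro c
    choose q hq using FrobAux.weight_rat w hw
    refine ⟨∑ i, q ((c : Fin n → R) i), ?_⟩
    simp only [wN, Complex.ofReal_sum, hq, Rat.cast_sum]
  · intro c hc
    have : wN w (c : Fin n → R) ∈ {x : ℝ | ∃ c ∈ C, c ≠ 0 ∧ wN w c = x} :=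
      ⟨c, c.2, fun h => hc (Subtype.ext h), rfl⟩
    rw [htw] at this
    simpa using this
end

section
/- Let C be a proper, regular, projective two-weight code of length n over a finite Frobenius ring R, with Γ(C) strongly regular having simple eigenvalue k and restricted eigenvalues ρ₁ < ρ₂ of multiplicities m₁ and m₂. Then m₁ = |C| − 1 − n|R^×| and m₂ = n|R^×|. -/
open scoped Classical in
lemma aux_fiber {α L : Type*} [Fintype α] [PartialOrder L] [Finite L] (p : α → L) (d : α → ℂ)
    (h : ∀ s, ∑ r with p r ≤ p s, d r = 0) : ∀ J, ∑ r with p r = J, d r = 0 := by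
  have : Fintype L := Fintype.ofFinite L
  intro J
  induction J using (Finite.wellFounded_of_trans_of_irrefl (α := L) (· < ·)).induction with
  | _ J ih =>
  by_cases hJ : ∃ s, p s = J
  · obtain ⟨s, rfl⟩ := hJ
    have h1 := h s
    rw [← Finset.sum_fiberwise_of_maps_to (t := Finset.univ.filter (· ≤ p s)) (g := p)
      (by intro i hi; simpa using hi)] at h1
    rw [Finset.sum_eq_single (p s)] at h1
    · rw [← h1, Finset.filter_filter]
      apply Finset.sum_congr _ (fun _ _ => rfl)
      ext r
      simp only [Finset.mem_filter, Finset.mem_univ, true_and]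
      exact ⟨fun h => ⟨h.le, h⟩, fun h => h.2⟩
    · intro b hb hbs
      simp only [Finset.mem_filter, Finset.mem_univ, true_and] at hb
      rw [← ih b (lt_of_le_of_ne hb hbs), Finset.filter_filter]
      apply Finset.sum_congr _ (fun _ _ => rfl)
      ext r
      simp only [Finset.mem_filter, Finset.mem_univ, true_and]
      exact ⟨fun h => h.2, fun h => ⟨h ▸ hb, h⟩⟩
    · intro h; simp at h
  · apply Finset.sum_eq_zero
    intro r hr
    simp only [Finset.mem_filter, Finset.mem_univ, true_and] at hr
    exact absurd ⟨r, hr⟩ hJ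

open scoped Classical in
lemma aux_sum_subgroup {G : Type*} [AddCommGroup G] [Fintype G] (T : AddSubgroup G)
    (ψ : AddChar G ℂ) (g : G) (hg : g ∈ T) (hψ : ψ g ≠ 1) : ∑ x with x ∈ T, ψ x = 0 := by
  have h : ∑ x with x ∈ T, ψ x = ψ g * ∑ x with x ∈ T, ψ x := by
    rw [Finset.mul_sum]
    symm
    refine Finset.sum_equiv (Equiv.addLeft g) ?_ ?_
    · intro i
      simp [AddSubgroup.add_mem_cancel_left T hg]
    · intro i _
      simp [AddChar.map_add_eq_mul]
  have h2 : (1 - ψ g) * ∑ x with x ∈ T, ψ x = 0 := by linear_combination h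
  rcases mul_eq_zero.1 h2 with h3 | h3
  · exact absurd (by linear_combination -h3) hψ
  · exact h3

lemma aux_left {R : Type*} [Ring R] [Fintype R] (χ : AddChar R ℂ)
    (hχ : ∀ φ : AddChar R ℂ, ∃ r : R, ∀ x : R, φ x = χ (r * x)) (x : R)
    (hx : ∀ r, χ (r * x) = 1) : x = 0 := by
  rw [← AddChar.forall_apply_eq_zero]
  intro φ
  obtain ⟨r, hr⟩ := hχ φ
  rw [hr, hx]

lemma aux_right {R : Type*} [Ring R] [Fintype R] (χ : AddChar R ℂ)
    (hχ : ∀ φ : AddChar R ℂ, ∃ r : R, ∀ x : R, φ x = χ (r * x)) (x : R)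
    (hx : ∀ r, χ (x * r) = 1) : x = 0 := by
  let f : R → AddChar R ℂ := fun r => χ.compAddMonoidHom (AddMonoidHom.mulLeft r)
  have hs : Function.Surjective f := by
    intro φ
    obtain ⟨r, hr⟩ := hχ φ
    exact ⟨r, by ext x; simp [f, hr]⟩
  have hb := (Fintype.bijective_iff_surjective_and_card f).2 ⟨hs, AddChar.card_eq.symm⟩
  apply hb.1
  ext r
  simp [f, hx]

open scoped Classical in
lemma aux_units {R : Type*} [Ring R] [Fintype R] (g : R → ℂ) :
    ∑ u : Rˣ, g u = ∑ r with Set.range (fun t => r * t) = Set.univ, g r := by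
  refine Finset.sum_bij (fun u _ => (u : R)) ?_ ?_ ?_ ?_
  · intro u _
    simp only [Finset.mem_filter, Finset.mem_univ, true_and]
    rw [Set.range_eq_univ]
    intro y
    exact ⟨↑u⁻¹ * y, by simp⟩
  · intro u _ v _ h
    exact Units.ext h
  · intro r hr
    simp only [Finset.mem_filter, Finset.mem_univ, true_and] at hr
    rw [Set.range_eq_univ] at hr
    obtain ⟨t, ht⟩ := hr 1
    exact ⟨⟨r, t, ht, mul_eq_one_symm ht⟩, Finset.mem_univ _, rfl⟩
  · intros; rfl

open scoped Classical in
lemma aux_inv {R : Type*} [Ring R] [Fintype R] (χ : AddChar R ℂ)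
    (hχ : ∀ φ : AddChar R ℂ, ∃ r : R, ∀ x : R, φ x = χ (r * x)) (a b : R)
    (hab : ∀ s, a * s = 0 ↔ b * s = 0) :
    ∑ u : Rˣ, χ (a * u) = ∑ u : Rˣ, χ (b * u) := by
  have key : ∀ a s : R, ∑ r with Set.range (fun t => r * t) ≤ Set.range (fun t => s * t), χ (a * r)
      = if a * s = 0 then
        ((Finset.univ.filter fun r : R =>
          Set.range (fun t => r * t) ≤ Set.range (fun t => s * t)).card : ℂ) else 0 := by
    intro a s
    have hmem : ∀ r : R, Set.range (fun t => r * t) ≤ Set.range (fun t => s * t) ↔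
        ∃ t, s * t = r := by
      intro r
      constructor
      · intro h
        exact h ⟨1, by simp⟩
      · rintro ⟨t, rfl⟩ _ ⟨y, rfl⟩
        exact ⟨t * y, by simp [mul_assoc]⟩
    split_ifs with h
    · rw [Finset.sum_congr rfl (g := fun _ => (1 : ℂ))]
      · simp
      · intro r hr
        simp only [Finset.mem_filter, Finset.mem_univ, true_and, hmem] at hr
        obtain ⟨t, rfl⟩ := hr
        rw [← mul_assoc, h]; simp
    · have : ∃ t, χ (a * s * t) ≠ 1 := by
        by_contra! hc
        exact h (aux_right χ hχ _ hc)
      obtain ⟨t, ht⟩ := this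
      have := aux_sum_subgroup (AddMonoidHom.mulLeft s).range
        (χ.compAddMonoidHom (AddMonoidHom.mulLeft a)) (s * t) ⟨t, rfl⟩
        (by simpa [mul_assoc] using ht)
      rw [← this]
      apply Finset.sum_congr
      · ext r; simp only [Finset.mem_filter, Finset.mem_univ, true_and, hmem]; rfl
      · intros; rfl
  have h := aux_fiber (fun r : R => Set.range (fun t => r * t))
    (fun r => χ (a * r) - χ (b * r)) (by
      intro s
      rw [Finset.sum_sub_distrib, key, key]
      simp only [hab s, sub_self]) Set.univ
  rw [aux_units (fun r => χ (a * r)), aux_units (fun r => χ (b * r))]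
  rw [Finset.sum_sub_distrib] at h
  exact sub_eq_zero.1 h

open scoped Classical in
lemma aux_weight {R : Type*} [Ring R] [Fintype R] (χ : AddChar R ℂ)
    (hχ : ∀ φ : AddChar R ℂ, ∃ r : R, ∀ x : R, φ x = χ (r * x))
    (w : R → ℝ) (γ : ℝ) (hw : IsHomWeight R w γ) (x : R) :
    (w x : ℂ) = γ * (1 - (∑ u : Rˣ, χ (x * u)) / (Nat.card Rˣ : ℂ)) := by
  obtain ⟨hw0, hw1, hw2⟩ := hw
  have hU : (Nat.card Rˣ : ℂ) ≠ 0 := by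
    have : 0 < Nat.card Rˣ := Nat.card_pos
    exact_mod_cast this.ne'
  let F : R → ℂ := fun x => γ * (1 - (∑ u : Rˣ, χ (x * u)) / (Nat.card Rˣ : ℂ))
  change (w x : ℂ) = F x
  have hF0 : F 0 = 0 := by
    simp only [F, zero_mul, AddChar.map_zero_eq_one]
    simp only [Finset.sum_const, Finset.card_univ, nsmul_eq_mul, mul_one, ← Nat.card_eq_fintype_card]
    rw [div_self hU]; simp
  have hF1 : ∀ x y : R, Submodule.span R ({x} : Set R) = Submodule.span R {y} → F x = F y := by
    intro x y h
    have : ∑ u : Rˣ, χ (x * u) = ∑ u : Rˣ, χ (y * u) := by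
      apply aux_inv χ hχ
      intro s
      have hx : x ∈ Submodule.span R ({y} : Set R) := h ▸ Submodule.mem_span_singleton_self x
      have hy : y ∈ Submodule.span R ({x} : Set R) := h ▸ Submodule.mem_span_singleton_self y
      obtain ⟨a, ha⟩ := Submodule.mem_span_singleton.1 hx
      obtain ⟨b, hb⟩ := Submodule.mem_span_singleton.1 hy
      simp only [smul_eq_mul] at ha hb
      constructor
      · intro h; rw [← hb, mul_assoc, h, mul_zero]
      · intro h; rw [← ha, mul_assoc, h, mul_zero]
    simp only [F, this]
  have hF2 : ∀ x : R, x ≠ 0 → ∑ y with y ∈ Submodule.span R ({x} : Set R), F y =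
      γ * Nat.card (Submodule.span R ({x} : Set R)) := by
    intro x hx
    have h0 : ∑ y with y ∈ Submodule.span R ({x} : Set R), ∑ u : Rˣ, χ (y * u) = 0 := by
      rw [Finset.sum_comm]
      apply Finset.sum_eq_zero
      intro u _
      have : ∃ t, χ (t * (x * u)) ≠ 1 := by
        by_contra! hc
        have := aux_left χ hχ _ hc
        exact hx (by simpa using this)
      obtain ⟨t, ht⟩ := this
      exact aux_sum_subgroup (Submodule.span R ({x} : Set R)).toAddSubgroup
        (χ.compAddMonoidHom (AddMonoidHom.mulRight (u : R))) (t * x)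
        (Submodule.smul_mem _ t (Submodule.mem_span_singleton_self x))
        (by simpa [mul_assoc] using ht)
    simp only [F]
    rw [← Finset.mul_sum, Finset.sum_sub_distrib, ← Finset.sum_div, h0]
    simp [Nat.card_eq_fintype_card, Fintype.card_subtype]
  have h := aux_fiber (fun r : R => Submodule.span R ({r} : Set R)) (fun r => (w r : ℂ) - F r) (by
    intro s
    have hle : ∀ r : R, Submodule.span R ({r} : Set R) ≤ Submodule.span R ({s} : Set R) ↔
      r ∈ Submodule.span R ({s} : Set R) := by
      intro r; rw [Submodule.span_singleton_le_iff_mem]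
    simp only [hle]
    by_cases hs : s = 0
    · subst hs
      apply Finset.sum_eq_zero
      intro r hr
      simp at hr
      simp [hr, hw0, hF0]
    · rw [Finset.sum_sub_distrib, hF2 s hs]
      have := hw2 s hs
      rw [finsum_mem_eq_sum_of_inter_support_eq (t := Finset.univ.filter
        (· ∈ Submodule.span R ({s} : Set R))) _ (by ext; simp)] at this
      rw [← Complex.ofReal_sum, this]
      simp)
  have h3 := h (Submodule.span R ({x} : Set R))
  rw [Finset.sum_congr rfl (g := fun _ => (w x : ℂ) - F x)] at h3
  · rw [Finset.sum_const, nsmul_eq_mul] at h3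
    rcases mul_eq_zero.1 h3 with h4 | h4
    · exfalso
      rw [Nat.cast_eq_zero, Finset.card_eq_zero] at h4
      have : x ∈ (∅ : Finset R) := by rw [← h4]; simp
      simp at this
    · exact sub_eq_zero.1 h4
  · intro r hr
    simp only [Finset.mem_filter, Finset.mem_univ, true_and] at hr
    rw [hw1 r x hr, hF1 r x hr]

lemma aux_idem_rank {V : Type*} [Fintype V] [DecidableEq V] (P : Matrix V V ℝ) (hP : P * P = P) :
    (Module.finrank ℝ (LinearMap.range (Matrix.toLin' P)) : ℝ) = P.trace := by
  have h : IsIdempotentElem (Matrix.toLin' P) := by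
    unfold IsIdempotentElem
    rw [Module.End.mul_eq_comp, ← Matrix.toLin'_mul, hP]
  rw [← (LinearMap.IsIdempotentElem.isProj_range _ h).trace, Matrix.trace_toLin'_eq]

lemma aux_linalg {V : Type*} [Fintype V] [Nonempty V] [DecidableEq V] (A P : Matrix V V ℝ)
    (hP : P * P = P) (hrow : ∀ a, ∑ b, P a b = 0) (hcol : ∀ b, ∑ a, P a b = 0) (N : ℕ)
    (htr : P.trace = N) (α β δ : ℝ) (hδ : 0 < δ)
    (hA : ∀ a b, A a b = α - (if a = b then β else 0) + δ * P a b)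
    (k ρ₁ ρ₂ : ℝ)
    (hk : ∀ a, ∑ b, A a b = k)
    (hρ₁ : ∃ v : V → ℝ, v ≠ 0 ∧ A.mulVec v = ρ₁ • v ∧ ∑ c, v c = 0)
    (hρ₂ : ∃ v : V → ℝ, v ≠ 0 ∧ A.mulVec v = ρ₂ • v ∧ ∑ c, v c = 0)
    (hρ : ρ₁ < ρ₂)
    (hsimple : Module.finrank ℝ
      ↥(Module.End.eigenspace (Matrix.toLin' A) k) = 1) :
    Module.finrank ℝ ↥(Module.End.eigenspace (Matrix.toLin' A) ρ₁) + N + 1 = Fintype.card V ∧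
    Module.finrank ℝ ↥(Module.End.eigenspace (Matrix.toLin' A) ρ₂) = N := by
  have hV : (Fintype.card V : ℝ) ≠ 0 := by exact_mod_cast Fintype.card_ne_zero
  have hAv : ∀ v : V → ℝ, ∀ a, A.mulVec v a = α * (∑ c, v c) - β * v a + δ * P.mulVec v a := by
    intro v a
    simp only [Matrix.mulVec, dotProduct, hA, Finset.mul_sum]
    have : β * v a = ∑ b, (if a = b then β else 0) * v b := by simp
    rw [this, ← Finset.sum_sub_distrib, ← Finset.sum_add_distrib]
    exact Finset.sum_congr rfl fun b _ => by ring
  have hsP : ∀ v : V → ℝ, ∑ a, P.mulVec v a = 0 := by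
    intro v
    simp only [Matrix.mulVec, dotProduct]
    rw [Finset.sum_comm]
    apply Finset.sum_eq_zero
    intro b _
    rw [← Finset.sum_mul, hcol, zero_mul]
  have hPP : ∀ v, P.mulVec (P.mulVec v) = P.mulVec v := by
    intro v; rw [Matrix.mulVec_mulVec, hP]
  have hkval : k = α * Fintype.card V - β := by
    obtain ⟨a⟩ := ‹Nonempty V›
    rw [← hk a]
    simp only [hA, Finset.sum_add_distrib, Finset.sum_sub_distrib, ← Finset.mul_sum, hrow]
    simp [mul_comm]
  have hsA : ∀ v, ∑ a, A.mulVec v a = k * ∑ c, v c := by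
    intro v
    simp only [hAv, Finset.sum_add_distrib, Finset.sum_sub_distrib, ← Finset.mul_sum, hsP, hkval]
    simp; ring
  have hone : A.mulVec (1 : V → ℝ) = k • (1 : V → ℝ) := by
    ext a
    simp [Matrix.mulVec, dotProduct, hk]
  have hmem : ∀ ρ v, v ∈ Module.End.eigenspace (Matrix.toLin' A) ρ ↔ A.mulVec v = ρ • v := by
    intro ρ v; rw [Module.End.mem_eigenspace_iff, Matrix.toLin'_apply]
  have hne : ∀ ρ, (∃ v : V → ℝ, v ≠ 0 ∧ A.mulVec v = ρ • v ∧ ∑ c, v c = 0) → ρ ≠ k := by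
    rintro ρ ⟨v, hv0, hv, hs⟩ rfl
    have h1 : (⟨1, (hmem _ _).2 hone⟩ : Module.End.eigenspace (Matrix.toLin' A) ρ) ≠ 0 := by
      intro h
      have := congrArg Subtype.val h
      simp at this
    obtain ⟨c, hc⟩ := (finrank_eq_one_iff_of_nonzero' _ h1).1 hsimple ⟨v, (hmem _ _).2 hv⟩
    have hc' : c • (1 : V → ℝ) = v := congrArg Subtype.val hc
    rw [← hc'] at hs
    simp [hV] at hs
    exact hv0 (by rw [← hc', hs, zero_smul])
  have hval : ∀ ρ, (∃ v : V → ℝ, v ≠ 0 ∧ A.mulVec v = ρ • v ∧ ∑ c, v c = 0) →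
      ρ = -β ∨ ρ = δ - β := by
    rintro ρ ⟨v, hv0, hv, hs⟩
    have h1 : (ρ + β) • v = δ • P.mulVec v := by
      ext a
      have := hAv v a
      rw [hv, hs] at this
      simp only [Pi.smul_apply, smul_eq_mul] at this ⊢
      linarith
    have h2 : (ρ + β) • P.mulVec v = δ • P.mulVec v := by
      have := congrArg P.mulVec h1
      rwa [Matrix.mulVec_smul, Matrix.mulVec_smul, hPP] at this
    by_cases hz : P.mulVec v = 0
    · rw [hz, smul_zero] at h1
      rcases smul_eq_zero.1 h1 with h | h
      · left; linarith
      · exact absurd h hv0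
    · right
      have := smul_left_injective ℝ hz h2
      linarith
  have hsz : ∀ ρ, ρ ≠ k → ∀ v, A.mulVec v = ρ • v → ∑ c, v c = 0 := by
    intro ρ hρk v hv
    have := hsA v
    rw [hv] at this
    simp only [Pi.smul_apply, smul_eq_mul, ← Finset.mul_sum] at this
    have h : (ρ - k) * ∑ c, v c = 0 := by linarith
    rcases mul_eq_zero.1 h with h | h
    · exact absurd (sub_eq_zero.1 h) hρk
    · exact h
  have e1 : ρ₁ = -β := by
    rcases hval _ hρ₁ with h | h
    · exact h
    · rcases hval _ hρ₂ with h' | h' <;> linarith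
  have e2 : ρ₂ = δ - β := by
    rcases hval _ hρ₂ with h | h
    · linarith
    · exact h
  have n1 := hne _ hρ₁
  have n2 := hne _ hρ₂
  clear hρ₁ hρ₂
  constructor
  · let Q : Matrix V V ℝ := P + Matrix.of fun _ _ => (Fintype.card V : ℝ)⁻¹
    have hQQ : Q * Q = Q := by
      ext a b
      simp only [Q, Matrix.mul_apply, Matrix.add_apply, Matrix.of_apply]
      have h : ∑ c, P a c * P c b = P a b := by rw [← Matrix.mul_apply, hP]
      simp only [add_mul, mul_add, Finset.sum_add_distrib, h, ← Finset.sum_mul, ← Finset.mul_sum,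
        hrow, hcol]
      simp [hV]
    have htQ : Q.trace = ((N + 1 : ℕ) : ℝ) := by
      rw [Matrix.trace_add, htr]
      simp [Matrix.trace, hV]
    have hr := aux_idem_rank Q hQQ
    rw [htQ, Nat.cast_inj] at hr
    have hQv : ∀ v a, Q.mulVec v a = P.mulVec v a + (Fintype.card V : ℝ)⁻¹ * ∑ c, v c := by
      intro v a
      simp [Q, Matrix.mulVec, dotProduct, Finset.mul_sum, add_mul, Finset.sum_add_distrib]
    have hE : Module.End.eigenspace (Matrix.toLin' A) ρ₁ = LinearMap.ker (Matrix.toLin' Q) := by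
      ext v
      rw [hmem, LinearMap.mem_ker, Matrix.toLin'_apply]
      constructor
      · intro hv
        have hs := hsz _ n1 v hv
        ext a
        have := hAv v a
        rw [hv, hs, e1] at this
        simp only [Pi.smul_apply, smul_eq_mul] at this
        have h3 : δ * P.mulVec v a = 0 := by linarith
        rw [hQv, hs]
        simpa [hδ.ne'] using h3
      · intro hv
        have hs : ∑ c, v c = 0 := by
          have : ∑ a, Q.mulVec v a = 0 := by rw [hv]; simp
          simp only [hQv, Finset.sum_add_distrib, hsP] at this
          simpa [hV] using this
        ext a
        have := hQv v a
        rw [hv, hs] at this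
        rw [hAv, hs, e1]
        simp only [Pi.zero_apply, mul_zero, add_zero] at this
        simp [← this]
    have := LinearMap.finrank_range_add_finrank_ker (Matrix.toLin' Q)
    rw [hr, ← hE, Module.finrank_fintype_fun_eq_card] at this
    omega
  · have hr := aux_idem_rank P hP
    rw [htr, Nat.cast_inj] at hr
    rw [← hr]
    suffices hE : Module.End.eigenspace (Matrix.toLin' A) ρ₂ = LinearMap.range (Matrix.toLin' P) by
      rw [hE]
    ext v
    rw [hmem, LinearMap.mem_range]
    constructor
    · intro hv
      refine ⟨v, ?_⟩
      have hs := hsz _ n2 v hv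
      ext a
      have := hAv v a
      rw [hv, hs, e2] at this
      simp only [Pi.smul_apply, smul_eq_mul] at this
      rw [Matrix.toLin'_apply]
      apply mul_left_cancel₀ hδ.ne'
      linarith
    · rintro ⟨u, rfl⟩
      rw [Matrix.toLin'_apply]
      ext a
      rw [hAv, hPP, hsP, e2]
      simp only [Pi.smul_apply, smul_eq_mul]
      ring

lemma aux_orth {G : Type*} [AddCommGroup G] [Fintype G] (ψ φ : AddChar G ℂ)
    [Decidable (ψ = φ)] (a c : G) :
    ∑ b, ψ (a - b) * φ (b - c) = if ψ = φ then Fintype.card G * ψ (a - c) else 0 := by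
  classical
  have h : ∀ b, ψ (a - b) * φ (b - c) = ψ a * φ (-c) * (φ - ψ) b := by
    intro b
    rw [AddChar.sub_apply', sub_eq_add_neg, sub_eq_add_neg, AddChar.map_add_eq_mul,
      AddChar.map_add_eq_mul, AddChar.map_neg_eq_inv ψ b]
    rw [div_eq_mul_inv]; ring
  simp only [h]
  rw [← Finset.mul_sum, AddChar.sum_eq_ite]
  by_cases hψ : ψ = φ
  · subst hψ
    simp [sub_eq_add_neg, AddChar.map_add_eq_mul]; ring
  · rw [if_neg hψ, if_neg (fun h => hψ (sub_eq_zero.1 h).symm), mul_zero]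

open scoped Classical in
/-- Let `C ≤ R^n` be a proper, regular, projective two-weight code over a
finite Frobenius ring `R`, with nonzero homogeneous weights `w₁ < w₂` (average value `γ`).
Suppose the Cayley graph `Γ(C)` (adjacency matrix `A`) is strongly regular with simple
eigenvalue `k` (the valency) and restricted eigenvalues `ρ₁ < ρ₂` of multiplicities `m₁`
and `m₂`.  Then `m₁ = |C| − 1 − n|R^×|` and `m₂ = n|R^×|`. -/
theorem stmt15 (R : Type*) [Ring R] [Fintype R]
    (hF : IsFrobeniusRing R) (w : R → ℝ) (γ : ℝ) (hw : IsHomWeight R w γ)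
    (ℓ n : ℕ) (Y : Matrix (Fin ℓ) (Fin n) R)
    (C : Submodule R (Fin n → R)) [Fintype ↥C]
    (hC : (C : Set (Fin n → R)) = Set.range fun x : Fin ℓ → R => fun j => ∑ i, x i * Y i j)
    (hreg : ∀ j : Fin n, ∀ r : R, ∃ x : Fin ℓ → R, ∑ i, x i * Y i j = r)
    (hproj : ∀ j j' : Fin n,
      (Set.range fun r : R => fun i => Y i j * r)
        = (Set.range fun r : R => fun i => Y i j' * r) → j = j')
    (hproper : ∀ c ∈ C, wN w c = 0 → c = 0)
    (w₁ w₂ : ℝ) (hw₁pos : 0 < w₁) (hw₁₂ : w₁ < w₂)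
    (htw : {x : ℝ | ∃ c ∈ C, c ≠ 0 ∧ wN w c = x} = {w₁, w₂})
    (A : Matrix ↥C ↥C ℝ)
    (hA : ∀ a b : ↥C, A a b = if wN w ((a : Fin n → R) - (b : Fin n → R)) = w₁ then 1 else 0)
    (k ρ₁ ρ₂ : ℝ)
    (hk : ∀ a : ↥C, ∑ b : ↥C, A a b = k)
    (hρ₁ : ∃ v : ↥C → ℝ, v ≠ 0 ∧ A.mulVec v = ρ₁ • v ∧ ∑ c : ↥C, v c = 0)
    (hρ₂ : ∃ v : ↥C → ℝ, v ≠ 0 ∧ A.mulVec v = ρ₂ • v ∧ ∑ c : ↥C, v c = 0)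
    (hρ : ρ₁ < ρ₂)
    (hsimple : Module.finrank ℝ
      ↥(Module.End.eigenspace (Matrix.toLin' A) k) = 1)
    (m₁ m₂ : ℕ)
    (hm₁ : m₁ = Module.finrank ℝ ↥(Module.End.eigenspace (Matrix.toLin' A) ρ₁))
    (hm₂ : m₂ = Module.finrank ℝ ↥(Module.End.eigenspace (Matrix.toLin' A) ρ₂)) :
    (m₁ : ℤ) = (Nat.card ↥C : ℤ) - 1 - n * (Nat.card Rˣ : ℤ) ∧
    m₂ = n * Nat.card Rˣ := by
  obtain ⟨χ, hχ⟩ := hF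
  have hW := aux_weight χ hχ w γ hw
  have hUpos : 0 < Nat.card Rˣ := Nat.card_pos
  have hU : (Nat.card Rˣ : ℝ) ≠ 0 := by exact_mod_cast hUpos.ne'
  have hUc : (Nat.card Rˣ : ℂ) ≠ 0 := by exact_mod_cast hUpos.ne'
  have hV : (Fintype.card C : ℝ) ≠ 0 := by exact_mod_cast Fintype.card_ne_zero
  have hVc : (Fintype.card C : ℂ) ≠ 0 := by exact_mod_cast Fintype.card_ne_zero
  have hw1ex : ∃ c ∈ C, c ≠ 0 ∧ wN w c = w₁ := by
    have : w₁ ∈ {x : ℝ | ∃ c ∈ C, c ≠ 0 ∧ wN w c = x} := by rw [htw]; simp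
    exact this
  have hwval : ∀ c ∈ C, c ≠ 0 → wN w c = w₁ ∨ wN w c = w₂ := by
    intro c hc h0
    have : wN w c ∈ {x : ℝ | ∃ c ∈ C, c ≠ 0 ∧ wN w c = x} := ⟨c, hc, h0, rfl⟩
    rw [htw] at this
    simpa using this
  have hwz : wN w (0 : Fin n → R) = 0 := by simp [wN, hw.1]
  have hγ0 : γ ≠ 0 := by
    rintro rfl
    obtain ⟨c, _, _, hc⟩ := hw1ex
    have h0 : ∀ x, w x = 0 := by
      intro x
      have := hW x
      simpa using this
    simp [wN, h0] at hc
    exact hw₁pos.ne hc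
  have hγc : (γ : ℂ) ≠ 0 := by exact_mod_cast hγ0
  have hnt : (1 : R) ≠ 0 := by
    intro h
    obtain ⟨c, _, h0, _⟩ := hw1ex
    have : Subsingleton R := subsingleton_of_zero_eq_one h.symm
    exact h0 (Subsingleton.elim _ _)
  have hCmem : ∀ x : Fin ℓ → R, (fun j => ∑ i, x i * Y i j) ∈ C := by
    intro x
    have : (fun j => ∑ i, x i * Y i j) ∈ (C : Set (Fin n → R)) := by rw [hC]; exact ⟨x, rfl⟩
    exact this
  let ev : Fin n × Rˣ → (C →+ R) := fun p =>
    { toFun := fun c => (c : Fin n → R) p.1 * (p.2 : R)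
      map_zero' := by simp
      map_add' := by intro a b; simp [add_mul] }
  let ψ : Fin n × Rˣ → AddChar C ℂ := fun p => χ.compAddMonoidHom (ev p)
  have hψ : ∀ p c, ψ p c = χ ((c : Fin n → R) p.1 * (p.2 : R)) := fun p c => rfl
  have hinj : Function.Injective ψ := by
    rintro ⟨i, u⟩ ⟨j, v⟩ h
    have h1 : ∀ k, Y k i * u = Y k j * v := by
      intro k
      rw [← sub_eq_zero]
      apply aux_left χ hχ
      intro r
      have h2 := DFunLike.congr_fun h ⟨_, hCmem (Pi.single k r)⟩
      simp only [hψ] at h2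
      simp only [Pi.single_apply, ite_mul, zero_mul, Finset.sum_ite_eq', Finset.mem_univ,
        if_true] at h2
      rw [mul_sub, ← mul_assoc, ← mul_assoc, sub_eq_add_neg, AddChar.map_add_eq_mul, h2,
        ← AddChar.map_add_eq_mul]
      simp
    have hij : i = j := by
      apply hproj
      ext z
      constructor
      · rintro ⟨r, rfl⟩
        refine ⟨v * (↑u⁻¹ * r), ?_⟩
        ext k
        simp only
        rw [← mul_assoc, ← h1 k, mul_assoc, Units.mul_inv_cancel_left]
      · rintro ⟨r, rfl⟩
        refine ⟨u * (↑v⁻¹ * r), ?_⟩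
        ext k
        simp only
        rw [← mul_assoc, h1 k, mul_assoc, Units.mul_inv_cancel_left]
    subst hij
    obtain ⟨x, hx⟩ := hreg i 1
    have huv : (u : R) = v := by
      rw [← one_mul (u : R), ← one_mul (v : R), ← hx, Finset.sum_mul, Finset.sum_mul]
      exact Finset.sum_congr rfl fun k _ => by rw [mul_assoc, h1, mul_assoc]
    rw [Units.ext huv]
  have hψ0 : ∀ p, ψ p ≠ 0 := by
    rintro ⟨i, u⟩ h
    apply hnt
    apply aux_left χ hχ
    intro r
    obtain ⟨x, hx⟩ := hreg i (r * ↑u⁻¹)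
    have h2 := DFunLike.congr_fun h ⟨_, hCmem x⟩
    simp only [hψ, hx] at h2
    simpa using h2
  let m : C → ℝ := fun c => Nat.card Rˣ * (n - wN w (c : Fin n → R) / γ)
  have hm : ∀ c, (m c : ℂ) = ∑ p, ψ p c := by
    intro c
    simp only [m, wN, hψ, Fintype.sum_prod_type]
    push_cast
    simp only [hW]
    rw [← Finset.mul_sum, Finset.sum_sub_distrib, ← Finset.sum_div]
    simp only [Finset.sum_const, Finset.card_univ, Fintype.card_fin, nsmul_eq_mul, mul_one]
    field_simp
    ring
  have hmsum : ∑ c, m c = 0 := by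
    have : ((∑ c, m c : ℝ) : ℂ) = 0 := by
      push_cast
      simp only [hm]
      rw [Finset.sum_comm]
      exact Finset.sum_eq_zero fun p _ => AddChar.sum_eq_zero_iff_ne_zero.2 (hψ0 p)
    exact_mod_cast this
  have hmconv : ∀ a c, ∑ b, m (a - b) * m (b - c) = Fintype.card C * m (a - c) := by
    intro a c
    have : ((∑ b, m (a - b) * m (b - c) : ℝ) : ℂ) = ((Fintype.card C * m (a - c) : ℝ) : ℂ) := by
      push_cast
      simp only [hm, Finset.sum_mul_sum]
      rw [Finset.sum_comm]
      rw [Finset.mul_sum]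
      refine Finset.sum_congr rfl fun p _ => ?_
      rw [Finset.sum_comm]
      simp only [aux_orth, hinj.eq_iff]
      simp
    exact_mod_cast this
  have hγ : 0 < γ := by
    have hpos : 0 < ∑ c : C, wN w (c : Fin n → R) := by
      apply Finset.sum_pos'
      · intro c _
        by_cases h : (c : Fin n → R) = 0
        · rw [h, hwz]
        · rcases hwval c c.2 h with h | h <;> rw [h] <;> linarith
      · obtain ⟨c, hc, _, h⟩ := hw1ex
        exact ⟨⟨c, hc⟩, Finset.mem_univ _, by simpa [h] using hw₁pos⟩
    have h1 : ∑ c : C, wN w (c : Fin n → R) = γ * (n * Fintype.card C) := by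
      have h2 := hmsum
      simp only [m] at h2
      rw [← Finset.mul_sum, Finset.sum_sub_distrib, ← Finset.sum_div] at h2
      have h3 := (mul_eq_zero.1 h2).resolve_left hU
      simp only [Finset.sum_const, Finset.card_univ, nsmul_eq_mul] at h3
      field_simp at h3
      linarith
    rw [h1] at hpos
    by_contra hneg
    have : γ * (n * Fintype.card C : ℝ) ≤ 0 :=
      mul_nonpos_of_nonpos_of_nonneg (not_lt.1 hneg) (by positivity)
    linarith
  let P : Matrix C C ℝ := Matrix.of fun a b => m (a - b) / Fintype.card C
  have hd : 0 < w₂ - w₁ := by linarith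
  have main := aux_linalg A P
    (by
      ext a c
      simp only [P, Matrix.mul_apply, Matrix.of_apply, div_mul_div_comm]
      rw [← Finset.sum_div, hmconv]
      field_simp)
    (by
      intro a
      simp only [P, Matrix.of_apply]
      have h := (Equiv.subLeft a).sum_comp m
      simp only [Equiv.subLeft_apply] at h
      rw [← Finset.sum_div, h, hmsum, zero_div])
    (by
      intro b
      simp only [P, Matrix.of_apply]
      have h := (Equiv.subRight b).sum_comp m
      simp only [Equiv.subRight_apply] at h
      rw [← Finset.sum_div, h, hmsum, zero_div])
    (n * Nat.card Rˣ)
    (by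
      simp only [P, Matrix.trace, Matrix.diag, Matrix.of_apply, sub_self, m]
      simp only [ZeroMemClass.coe_zero, hwz]
      simp
      field_simp)
    ((w₂ - γ * n) / (w₂ - w₁)) (w₂ / (w₂ - w₁))
    (γ * Fintype.card C / (Nat.card Rˣ * (w₂ - w₁)))
    (by
      have : (0 : ℝ) < Nat.card Rˣ := by exact_mod_cast hUpos
      have : (0 : ℝ) < Fintype.card C := by exact_mod_cast Fintype.card_pos
      positivity)
    (by
      intro a b
      rw [hA]
      simp only [P, Matrix.of_apply, m, AddSubgroupClass.coe_sub]
      by_cases hab : a = b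
      · subst hab
        rw [sub_self, hwz, if_neg hw₁pos.ne, if_pos rfl]
        field_simp
        ring
      · have h0 : (a : Fin n → R) - b ≠ 0 := by
          intro h
          exact hab (Subtype.ext (sub_eq_zero.1 h))
        rw [if_neg hab]
        rcases hwval _ (C.sub_mem a.2 b.2) h0 with h | h
        · rw [h, if_pos rfl]
          field_simp
          ring
        · rw [h, if_neg hw₁₂.ne']
          field_simp
          ring)
    k ρ₁ ρ₂ hk hρ₁ hρ₂ hρ hsimple
  rw [← hm₁, ← hm₂] at main
  refine ⟨?_, main.2⟩
  rw [Nat.card_eq_fintype_card (α := C), ← main.1]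
  push_cast
  ring
end
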